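/- Let d ≥ 1, 0 ≤ t₀ < T₁, r > 0, O := { x ∈ ℝ^d : |x| < r }, Q := [t₀,T₁) × O, ∂Q := ([t₀,T₁] × ∂O) ∪ ({T₁} × O) and Q̄ := [t₀,T₁] × Ō. Let g : [t₀,T₁] × ℝ × ℝ^d × S^d → ℝ be continuous and satisfy: |g(s,0,0,0)| ≤ C₀ for all s; g is uniformly Lipschitz in (y,z,γ) with constant L₀; and g is uniformly elliptic: there is c₀ > 0 with g(s,y,z,γ₁) − g(s,y,z,γ₂) ≥ c₀ tr(γ₁ − γ₂) whenever γ₁ − γ₂ is positive semidefinite. Then: (i) the comparison principle holds for bounded viscosity solutions: if u is a bounded upper semicontinuous viscosity subsolution and v a bounded lower semicontinuous viscosity supersolution of −∂_t w − g(s, w, Dw, D²w) = 0 on Q with u ≤ v on ∂Q, then u ≤ v on Q̄; (ii) for every bounded continuous h : ∂Q → ℝ there exists a unique bounded continuous viscosity solution v of this PDE on Q with v = h on ∂Q. -/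

import Mathlib

/-- The continuous linear map on Euclidean space induced by a matrix. -/
noncomputable def matCLM (d : ℕ) (γ : Matrix (Fin d) (Fin d) ℝ) :
    EuclideanSpace ℝ (Fin d) →L[ℝ] EuclideanSpace ℝ (Fin d) :=
  Matrix.toEuclideanCLM (𝕜 := ℝ) γ

/-- A norm on `d × d` matrices: the operator norm of the induced map on Euclidean space. -/
noncomputable def matNorm (d : ℕ) (γ : Matrix (Fin d) (Fin d) ℝ) : ℝ :=
  ‖matCLM d γ‖

/-- The parabolic cylinder `Q = [t₀,T₁) × O`, `O` the open ball of radius `r`. -/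
def cylQ (d : ℕ) (t₀ T₁ r : ℝ) : Set (ℝ × EuclideanSpace ℝ (Fin d)) :=
  Set.Ico t₀ T₁ ×ˢ Metric.ball 0 r

/-- The closure `Q̄ = [t₀,T₁] × Ō`. -/
def cylQbar (d : ℕ) (t₀ T₁ r : ℝ) : Set (ℝ × EuclideanSpace ℝ (Fin d)) :=
  Set.Icc t₀ T₁ ×ˢ Metric.closedBall 0 r

/-- The parabolic boundary `∂Q = ([t₀,T₁] × ∂O) ∪ ({T₁} × O)`. -/
def cylBdry (d : ℕ) (t₀ T₁ r : ℝ) : Set (ℝ × EuclideanSpace ℝ (Fin d)) :=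
  (Set.Icc t₀ T₁ ×ˢ Metric.sphere 0 r) ∪ ({T₁} ×ˢ Metric.ball 0 r)

/-- The viscosity subsolution property for `−∂_t w − g(s,w,Dw,D²w) = 0` on `Q`: whenever a
test function `φ`, of class `C^{1,2}` on an open neighborhood `U` of a point `p ∈ Q` (with
time derivative `φt`, spatial gradient `Dφ` and symmetric spatial Hessian `D2φ`, all
continuous on `U`), is such that `u − φ` attains a local maximum equal to `0` at `p` over
`U ∩ Q`, then `−φt(p) − g(p₁, u(p), Dφ(p), D²φ(p)) ≤ 0`. -/
def ViscSubsolProp (d : ℕ)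
    (g : ℝ → ℝ → EuclideanSpace ℝ (Fin d) → Matrix (Fin d) (Fin d) ℝ → ℝ)
    (Q : Set (ℝ × EuclideanSpace ℝ (Fin d)))
    (u : ℝ × EuclideanSpace ℝ (Fin d) → ℝ) : Prop :=
  ∀ p ∈ Q, ∀ (φ φt : ℝ × EuclideanSpace ℝ (Fin d) → ℝ)
    (Dφ : ℝ × EuclideanSpace ℝ (Fin d) → EuclideanSpace ℝ (Fin d))
    (D2φ : ℝ × EuclideanSpace ℝ (Fin d) → Matrix (Fin d) (Fin d) ℝ)
    (U : Set (ℝ × EuclideanSpace ℝ (Fin d))),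
    IsOpen U → p ∈ U →
    ContinuousOn φ U → ContinuousOn φt U → ContinuousOn Dφ U → ContinuousOn D2φ U →
    (∀ q ∈ U,
      HasDerivAt (fun s => φ (s, q.2)) (φt q) q.1 ∧
      HasGradientAt (fun x => φ (q.1, x)) (Dφ q) q.2 ∧
      HasFDerivAt (fun x => Dφ (q.1, x)) (matCLM d (D2φ q)) q.2 ∧
      (D2φ q).IsSymm) →
    u p = φ p → (∀ q ∈ U ∩ Q, u q ≤ φ q) →
    -φt p - g p.1 (u p) (Dφ p) (D2φ p) ≤ 0

/-- The viscosity supersolution property (local minima, reversed inequality). -/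
def ViscSupersolProp (d : ℕ)
    (g : ℝ → ℝ → EuclideanSpace ℝ (Fin d) → Matrix (Fin d) (Fin d) ℝ → ℝ)
    (Q : Set (ℝ × EuclideanSpace ℝ (Fin d)))
    (u : ℝ × EuclideanSpace ℝ (Fin d) → ℝ) : Prop :=
  ∀ p ∈ Q, ∀ (φ φt : ℝ × EuclideanSpace ℝ (Fin d) → ℝ)
    (Dφ : ℝ × EuclideanSpace ℝ (Fin d) → EuclideanSpace ℝ (Fin d))
    (D2φ : ℝ × EuclideanSpace ℝ (Fin d) → Matrix (Fin d) (Fin d) ℝ)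
    (U : Set (ℝ × EuclideanSpace ℝ (Fin d))),
    IsOpen U → p ∈ U →
    ContinuousOn φ U → ContinuousOn φt U → ContinuousOn Dφ U → ContinuousOn D2φ U →
    (∀ q ∈ U,
      HasDerivAt (fun s => φ (s, q.2)) (φt q) q.1 ∧
      HasGradientAt (fun x => φ (q.1, x)) (Dφ q) q.2 ∧
      HasFDerivAt (fun x => Dφ (q.1, x)) (matCLM d (D2φ q)) q.2 ∧
      (D2φ q).IsSymm) →
    u p = φ p → (∀ q ∈ U ∩ Q, φ q ≤ u q) →
    0 ≤ -φt p - g p.1 (u p) (Dφ p) (D2φ p)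

section ParabolicViscosity

open Set Filter Topology MeasureTheory
open scoped RealInnerProductSpace

section SupConvolution

variable {F : Type*} [NormedAddCommGroup F] [InnerProductSpace ℝ F]

/-- A midpoint inequality together with a quadratic lower bound yields nonnegativity. -/
lemma nonneg_of_two_mul_half_le {D : F → ℝ} {C : ℝ} (h1 : ∀ h, 2 * D ((1 / 2 : ℝ) • h) ≤ D h)
    (h2 : ∀ h, -(C * ‖h‖ ^ 2) ≤ D h) (h : F) : 0 ≤ D h := by
  have key : ∀ (n : ℕ) (h : F), -(C * ‖h‖ ^ 2) * (1 / 2) ^ n ≤ D h := by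
    intro n
    induction n with
    | zero => intro h; simpa using h2 h
    | succ n ih =>
      intro h
      have h3 := ih ((1 / 2 : ℝ) • h)
      have h4 := h1 h
      have h5 : ‖(1 / 2 : ℝ) • h‖ ^ 2 = ‖h‖ ^ 2 / 4 := by
        rw [norm_smul]; norm_num; ring
      rw [h5] at h3
      have : -(C * ‖h‖ ^ 2) * (1 / 2) ^ (n + 1) = 2 * (-(C * (‖h‖ ^ 2 / 4)) * (1 / 2) ^ n) := by
        ring
      linarith
  have hlim : Tendsto (fun n : ℕ => -(C * ‖h‖ ^ 2) * (1 / 2 : ℝ) ^ n) atTop (𝓝 0) := by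
    simpa using (tendsto_pow_atTop_nhds_zero_of_lt_one (by norm_num : (0 : ℝ) ≤ 1 / 2)
      (by norm_num)).const_mul (-(C * ‖h‖ ^ 2))
  exact le_of_tendsto' hlim fun n => key n h

variable [FiniteDimensional ℝ F]

/-- A regularization from above of an upper semicontinuous function `u` on a compact set: it
dominates the sup-convolution of `u`, lies below every paraboloid dominating this
sup-convolution, and is squeezed between two touching paraboloids at every point. -/
lemma exists_c11_envelope {S : Set F} (hS : IsCompact S) (hne : S.Nonempty) {u : F → ℝ}
    (hu : UpperSemicontinuousOn u S) {k : ℝ} (hk : 0 < k) :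
    ∃ (U : F → ℝ) (q : F → F),
      (∀ x ∈ S, ∀ z, u x - k * ‖x - z‖ ^ 2 ≤ U z) ∧
      (∀ b e, (∀ x ∈ S, ∀ z, u x - k * ‖x - z‖ ^ 2 ≤ e + k * ‖z - b‖ ^ 2) →
        ∀ z, U z ≤ e + k * ‖z - b‖ ^ 2) ∧
      (∀ z h, U (z + h) ≤ U z + ⟪q z, h⟫ + k * ‖h‖ ^ 2) ∧
      (∀ z h, U z + ⟪q z, h⟫ - k * ‖h‖ ^ 2 ≤ U (z + h)) := by
  have hex : ∀ ζ : F, ∃ x ∈ S, ∀ y ∈ S, u y - k / 2 * ‖y - ζ‖ ^ 2 ≤ u x - k / 2 * ‖x - ζ‖ ^ 2 := by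
    intro ζ
    have : UpperSemicontinuousOn (fun x => u x + -(k / 2 * ‖x - ζ‖ ^ 2)) S :=
      hu.add ((Continuous.upperSemicontinuous (by fun_prop)).upperSemicontinuousOn _)
    obtain ⟨x, hx, hmax⟩ := this.exists_isMaxOn hne hS
    exact ⟨x, hx, fun y hy => by linarith [isMaxOn_iff.1 hmax y hy]⟩
  choose X hXS hX using hex
  set m : F → ℝ := fun ζ => u (X ζ) - k / 2 * ‖X ζ - ζ‖ ^ 2 with hm
  have m1 : ∀ ζ, ∀ x ∈ S, u x - k / 2 * ‖x - ζ‖ ^ 2 ≤ m ζ := fun ζ x hx => hX ζ x hx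
  have m_lsc : LowerSemicontinuous m := by
    intro ζ c hc
    have hcont : ContinuousAt (fun ζ' => u (X ζ) - k / 2 * ‖X ζ - ζ'‖ ^ 2) ζ := by fun_prop
    filter_upwards [hcont.eventually (lt_mem_nhds hc)] with ζ' hζ'
    exact lt_of_lt_of_le hζ' (m1 ζ' _ (hXS ζ))
  have m_mid : ∀ ζ w, 2 * m ζ - k * ‖w‖ ^ 2 ≤ m (ζ + w) + m (ζ - w) := by
    intro ζ w
    have h1 := m1 (ζ + w) _ (hXS ζ)
    have h2 := m1 (ζ - w) _ (hXS ζ)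
    have h3 := parallelogram_law_with_norm ℝ (X ζ - ζ) w
    rw [show X ζ - (ζ + w) = X ζ - ζ - w by abel] at h1
    rw [show X ζ - (ζ - w) = X ζ - ζ + w by abel] at h2
    simp only [hm] at h1 h2 ⊢
    nlinarith
  obtain ⟨x0, hx0⟩ := hne
  have hmin : ∀ z : F, ∃ ζ, ∀ ζ', m ζ + k * ‖ζ - z‖ ^ 2 ≤ m ζ' + k * ‖ζ' - z‖ ^ 2 := by
    intro z
    have hlsc : LowerSemicontinuous fun ζ => m ζ + k * ‖ζ - z‖ ^ 2 :=
      m_lsc.add (Continuous.lowerSemicontinuous (by fun_prop))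
    have hlow : ∀ ζ, u x0 - 3 * k / 2 * ‖x0 - z‖ ^ 2 + k / 4 * ‖ζ - z‖ ^ 2
        ≤ m ζ + k * ‖ζ - z‖ ^ 2 := by
      intro ζ
      have h1 := m1 ζ x0 hx0
      have h2 : ‖x0 - ζ‖ ^ 2 ≤ 3 / 2 * ‖ζ - z‖ ^ 2 + 3 * ‖x0 - z‖ ^ 2 := by
        have h3 : ‖x0 - ζ‖ ≤ ‖x0 - z‖ + ‖ζ - z‖ := by
          have := norm_sub_le (x0 - z) (ζ - z)
          rwa [sub_sub_sub_cancel_right] at this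
        nlinarith [sq_nonneg (‖ζ - z‖ - 2 * ‖x0 - z‖), norm_nonneg (x0 - ζ), norm_nonneg (x0 - z),
          norm_nonneg (ζ - z)]
      nlinarith
    set a := m z + k * ‖z - z‖ ^ 2 - (u x0 - 3 * k / 2 * ‖x0 - z‖ ^ 2) with ha
    have ha0 : 0 ≤ a := by have := hlow z; simp at this; simp [ha]; linarith
    set R := 1 + 4 * a / k with hR
    have hR1 : 1 ≤ R := by rw [hR]; have : 0 ≤ 4 * a / k := by positivity
                           linarith
    obtain ⟨ζ, hζ, hζmin⟩ := (hlsc.lowerSemicontinuousOn (Metric.closedBall z R)).exists_isMinOn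
      ⟨z, Metric.mem_closedBall_self (by linarith)⟩ (isCompact_closedBall z R)
    refine ⟨ζ, fun ζ' => ?_⟩
    by_cases hb : ζ' ∈ Metric.closedBall z R
    · exact hζmin hb
    · have h1 : m ζ + k * ‖ζ - z‖ ^ 2 ≤ m z + k * ‖z - z‖ ^ 2 :=
        hζmin (Metric.mem_closedBall_self (by linarith))
      have h2 := hlow ζ'
      have h3 : R < ‖ζ' - z‖ := by
        rw [Metric.mem_closedBall, dist_eq_norm] at hb; exact not_le.1 hb
      have h4 : k / 4 * R ≤ k / 4 * ‖ζ' - z‖ ^ 2 := by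
        have : R ≤ ‖ζ' - z‖ ^ 2 := by nlinarith
        gcongr
      have h5 : k / 4 * R = k / 4 + a := by rw [hR]; field_simp
      linarith
  choose Z hZ using hmin
  set U : F → ℝ := fun z => m (Z z) + k * ‖Z z - z‖ ^ 2 with hU
  have Umid : ∀ z h, 2 * U z - 2 * k * ‖h‖ ^ 2 ≤ U (z + h) + U (z - h) := by
    intro z h
    set a := Z (z + h)
    set b := Z (z - h)
    set c := (1 / 2 : ℝ) • (a + b)
    set w := (1 / 2 : ℝ) • (a - b)
    have hac : a = c + w := by simp only [c, w]; module
    have hbc : b = c - w := by simp only [c, w]; module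
    have h1 := m_mid c w
    have h2 : U z ≤ m c + k * ‖c - z‖ ^ 2 := hZ z c
    have h3 : U (z + h) = m (c + w) + k * ‖(c - z) + (w - h)‖ ^ 2 := by
      rw [show (c - z) + (w - h) = (c + w) - (z + h) by abel, ← hac]
    have h4 : U (z - h) = m (c - w) + k * ‖(c - z) - (w - h)‖ ^ 2 := by
      rw [show (c - z) - (w - h) = (c - w) - (z - h) by abel, ← hbc]
    have h5 := parallelogram_law_with_norm ℝ (c - z) (w - h)
    have h6 : ‖w‖ ^ 2 ≤ 2 * ‖w - h‖ ^ 2 + 2 * ‖h‖ ^ 2 := by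
      have h7 : ‖w‖ ≤ ‖w - h‖ + ‖h‖ := by simpa using norm_add_le (w - h) h
      nlinarith [sq_nonneg (‖w - h‖ - ‖h‖), norm_nonneg w]
    rw [h3, h4]
    nlinarith
  have Uup : ∀ z h, U (z + h) ≤ U z + ⟪(2 * k) • (z - Z z), h⟫ + k * ‖h‖ ^ 2 := by
    intro z h
    have h1 : U (z + h) ≤ m (Z z) + k * ‖Z z - (z + h)‖ ^ 2 := hZ (z + h) (Z z)
    have h2 : ‖Z z - (z + h)‖ ^ 2 = ‖Z z - z‖ ^ 2 + 2 * ⟪z - Z z, h⟫ + ‖h‖ ^ 2 := by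
      rw [show Z z - (z + h) = -((z - Z z) + h) by abel, norm_neg, norm_add_sq_real,
        norm_sub_rev]
    rw [h2] at h1
    rw [inner_smul_left]
    simp only [hU, conj_trivial] at h1 ⊢
    linarith
  refine ⟨U, fun z => (2 * k) • (z - Z z), ?_, ?_, Uup, ?_⟩
  · intro x hx z
    have h1 := m1 (Z z) x hx
    have h2 : ‖x - Z z‖ ^ 2 ≤ 2 * ‖x - z‖ ^ 2 + 2 * ‖Z z - z‖ ^ 2 := by
      have h3 : ‖x - Z z‖ ≤ ‖x - z‖ + ‖Z z - z‖ := by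
        have := norm_sub_le (x - z) (Z z - z)
        rwa [sub_sub_sub_cancel_right] at this
      nlinarith [sq_nonneg (‖x - z‖ - ‖Z z - z‖), norm_nonneg (x - Z z)]
    simp only [hU]
    nlinarith
  · intro b e h z
    have h1 : U z ≤ m b + k * ‖b - z‖ ^ 2 := hZ z b
    have h2 : m b ≤ e := by
      have h3 := h (X b) (hXS b) ((1 / 2 : ℝ) • (X b + b))
      rw [show X b - (1 / 2 : ℝ) • (X b + b) = (1 / 2 : ℝ) • (X b - b) by module,
        show (1 / 2 : ℝ) • (X b + b) - b = (1 / 2 : ℝ) • (X b - b) by module, norm_smul,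
        mul_pow] at h3
      norm_num at h3
      simp only [hm]
      linarith
    rw [norm_sub_rev] at h1
    linarith
  · intro z h
    have := nonneg_of_two_mul_half_le (C := 2 * k)
      (D := fun h => U (z + h) - U z - ⟪(2 * k) • (z - Z z), h⟫ + k * ‖h‖ ^ 2) ?_ ?_ h
    · linarith
    · intro h
      have h1 := Umid (z + (1 / 2 : ℝ) • h) ((1 / 2 : ℝ) • h)
      rw [add_sub_cancel_right, show z + (1 / 2 : ℝ) • h + (1 / 2 : ℝ) • h = z + h by module] at h1
      have h5 : ‖(1 / 2 : ℝ) • h‖ ^ 2 = ‖h‖ ^ 2 / 4 := by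
        rw [norm_smul]; norm_num; ring
      rw [h5] at h1
      simp only [inner_smul_right, h5]
      linarith
    · intro h
      have h1 := Umid z h
      have h2 := Uup z (-h)
      rw [← sub_eq_add_neg, inner_neg_right, norm_neg] at h2
      linarith

end SupConvolution

section SecondOrder

variable {F : Type*} [NormedAddCommGroup F] [InnerProductSpace ℝ F]

lemma norm_gradient_sub_le_of_paraboloids {U : F → ℝ} {q : F → F} {k : ℝ}
    (hup : ∀ z h, U (z + h) ≤ U z + ⟪q z, h⟫ + k * ‖h‖ ^ 2)
    (hlo : ∀ z h, U z + ⟪q z, h⟫ - k * ‖h‖ ^ 2 ≤ U (z + h)) (hk : 0 ≤ k) (z₁ z₂ : F) :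
    ‖q z₂ - q z₁‖ ≤ 6 * k * ‖z₂ - z₁‖ := by
  set w := z₂ - z₁ with hw
  set e := q z₂ - q z₁ with he
  rcases eq_or_ne w 0 with h0 | h0
  · have : z₂ = z₁ := sub_eq_zero.1 h0
    simp [he, h0, this]
  rcases eq_or_ne e 0 with h1 | h1
  · rw [h1, norm_zero]; positivity
  have hwp : 0 < ‖w‖ := norm_pos_iff.2 h0
  have hep : 0 < ‖e‖ := norm_pos_iff.2 h1
  set v := (‖w‖ / ‖e‖) • e with hv
  have hvn : ‖v‖ = ‖w‖ := by
    rw [hv, norm_smul, Real.norm_of_nonneg (by positivity)]; field_simp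
  have hev : ⟪e, v⟫ = ‖w‖ * ‖e‖ := by
    rw [hv, inner_smul_right, real_inner_self_eq_norm_sq]; field_simp
  have a1 := hup z₁ (w + v)
  have a2 := hlo z₂ v
  have a3 := hlo z₁ w
  rw [show z₁ + (w + v) = z₂ + v by rw [hw]; abel] at a1
  rw [show z₁ + w = z₂ by rw [hw]; abel] at a3
  have a4 : ⟪e, v⟫ = ⟪q z₂, v⟫ - ⟪q z₁, v⟫ := by rw [he, inner_sub_left]
  have a5 : ‖w + v‖ ≤ 2 * ‖w‖ := by linarith [norm_add_le w v]
  have a6 : ‖w + v‖ ^ 2 ≤ 4 * ‖w‖ ^ 2 := by nlinarith [norm_nonneg (w + v)]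
  rw [inner_add_right] at a1
  rw [hvn] at a2
  have a7 : ‖w‖ * ‖e‖ ≤ ‖w‖ * (6 * k * ‖w‖) := by nlinarith
  exact le_of_mul_le_mul_left a7 hwp

lemma eq_zero_and_nonpos_of_quadratic_le {g : F} {A : F →L[ℝ] F}
    (h : ∀ κ > 0, ∃ ρ > 0, ∀ w : F, ‖w‖ < ρ → ⟪g, w⟫ + 1 / 2 * ⟪A w, w⟫ ≤ κ * ‖w‖ ^ 2) :
    g = 0 ∧ ∀ w, ⟪A w, w⟫ ≤ 0 := by
  have scale : ∀ (w : F) (κ : ℝ), 0 < κ → ∃ t₀ > 0, ∀ t, 0 < t → t < t₀ →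
      ⟪g, w⟫ + t * (1 / 2 * ⟪A w, w⟫) ≤ t * (κ * ‖w‖ ^ 2) := by
    intro w κ hκ
    obtain ⟨ρ, hρ, H⟩ := h κ hκ
    refine ⟨ρ / (‖w‖ + 1), by positivity, fun t ht ht' => ?_⟩
    have h1 : ‖t • w‖ < ρ := by
      rw [norm_smul, Real.norm_of_nonneg ht.le]
      rw [lt_div_iff₀ (by positivity)] at ht'
      nlinarith
    have h2 := H _ h1
    simp only [map_smul, inner_smul_left, inner_smul_right, norm_smul, Real.norm_of_nonneg ht.le,
      conj_trivial, mul_pow] at h2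
    refine le_of_mul_le_mul_left ?_ ht
    nlinarith
  have lim : ∀ (w : F) (κ : ℝ), 0 < κ → ⟪g, w⟫ ≤ 0 := by
    intro w κ hκ
    obtain ⟨t₀, ht₀, H⟩ := scale w κ hκ
    have h1 : Tendsto (fun t : ℝ => t * (κ * ‖w‖ ^ 2 - 1 / 2 * ⟪A w, w⟫)) (𝓝[>] 0) (𝓝 0) := by
      have : Continuous fun t : ℝ => t * (κ * ‖w‖ ^ 2 - 1 / 2 * ⟪A w, w⟫) := by fun_prop
      simpa using this.continuousWithinAt.tendsto (x := (0 : ℝ)) (s := Ioi 0)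
    refine ge_of_tendsto h1 ?_
    filter_upwards [Ioo_mem_nhdsGT ht₀] with t ht
    have := H t ht.1 ht.2
    linarith
  have hg : g = 0 := by
    have := lim g 1 one_pos
    rw [real_inner_self_eq_norm_sq] at this
    exact norm_eq_zero.1 (by nlinarith [norm_nonneg g])
  refine ⟨hg, fun w => ?_⟩
  have h2 : ∀ κ > 0, 1 / 2 * ⟪A w, w⟫ ≤ κ * ‖w‖ ^ 2 := by
    intro κ hκ
    obtain ⟨t₀, ht₀, H⟩ := scale w κ hκ
    have := H (t₀ / 2) (by positivity) (by linarith)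
    rw [hg, inner_zero_left, zero_add] at this
    exact le_of_mul_le_mul_left this (by positivity)
  have h3 : ∀ κ > 0, 1 / 2 * ⟪A w, w⟫ ≤ 0 + κ := by
    intro κ hκ
    have h4 := h2 (κ / (‖w‖ ^ 2 + 1)) (by positivity)
    have h5 : κ / (‖w‖ ^ 2 + 1) * ‖w‖ ^ 2 ≤ κ := by
      rw [div_mul_eq_mul_div, div_le_iff₀ (by positivity)]
      nlinarith
    linarith
  have := le_of_forall_pos_le_add h3
  linarith

variable [CompleteSpace F]

lemma hasGradientAt_of_paraboloids {U : F → ℝ} {q : F → F} {k : ℝ}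
    (hup : ∀ z h, U (z + h) ≤ U z + ⟪q z, h⟫ + k * ‖h‖ ^ 2)
    (hlo : ∀ z h, U z + ⟪q z, h⟫ - k * ‖h‖ ^ 2 ≤ U (z + h)) (z : F) :
    HasGradientAt U (q z) z := by
  rw [hasGradientAt_iff_hasFDerivAt, hasFDerivAt_iff_isLittleO_nhds_zero]
  have h1 : (fun h : F => U (z + h) - U z - InnerProductSpace.toDual ℝ F (q z) h)
      =O[𝓝 0] fun h : F => ‖h‖ ^ 2 := by
    refine Asymptotics.IsBigO.of_bound k (Eventually.of_forall fun h => ?_)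
    rw [InnerProductSpace.toDual_apply_apply, Real.norm_eq_abs, norm_pow, norm_norm, abs_le]
    constructor <;> linarith [hup z h, hlo z h]
  refine h1.trans_isLittleO ?_
  have := (Asymptotics.isLittleO_norm_pow_id (E' := F) one_lt_two)
  simpa using this

/-- Second order Taylor expansion at a point where the gradient is differentiable. -/
lemma exists_taylor_two {f : F → ℝ} {G : F → F} {A : F →L[ℝ] F} {x : F}
    (hf : ∀ᶠ y in 𝓝 x, HasGradientAt f (G y) y) (hG : HasFDerivAt G A x) {κ : ℝ} (hκ : 0 < κ) :
    ∃ ρ > 0, ∀ h, ‖h‖ < ρ →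
      |f (x + h) - f x - ⟪G x, h⟫ - 1 / 2 * ⟪A h, h⟫| ≤ κ * ‖h‖ ^ 2 := by
  have h1 := hG.isLittleO.def hκ
  obtain ⟨ρ, hρ, H⟩ := Metric.eventually_nhds_iff.1 (hf.and h1)
  refine ⟨ρ, hρ, fun h hh => ?_⟩
  have hx : ∀ t ∈ Icc (0 : ℝ) 1, dist (x + t • h) x < ρ := by
    intro t ht
    rw [dist_eq_norm, add_sub_cancel_left, norm_smul, Real.norm_of_nonneg ht.1]
    nlinarith [norm_nonneg h, ht.2]
  have hd : ∀ t ∈ Icc (0 : ℝ) 1, HasDerivWithinAt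
      (fun t : ℝ => f (x + t • h) - t * ⟪G x, h⟫ - t ^ 2 * (1 / 2 * ⟪A h, h⟫))
      (⟪G (x + t • h), h⟫ - ⟪G x, h⟫ - t * ⟪A h, h⟫) (Icc 0 1) t := by
    intro t ht
    have d1 := ((H (hx t ht)).1.hasFDerivAt).comp_hasDerivAt t
      (((hasDerivAt_id t).smul_const h).const_add x)
    simp only [InnerProductSpace.toDual_apply_apply, one_smul] at d1
    have d2 := (hasDerivAt_id t).mul_const ⟪G x, h⟫
    have d3 := (hasDerivAt_pow 2 t).mul_const (1 / 2 * ⟪A h, h⟫)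
    have := ((d1.sub d2).sub d3).hasDerivWithinAt (s := Icc 0 1)
    exact this.congr_deriv (by simp; ring)
  have hb : ∀ t ∈ Ico (0 : ℝ) 1,
      ‖⟪G (x + t • h), h⟫ - ⟪G x, h⟫ - t * ⟪A h, h⟫‖ ≤ κ * ‖h‖ ^ 2 := by
    intro t ht
    have h2 := (H (hx t ⟨ht.1, ht.2.le⟩)).2
    rw [add_sub_cancel_left, map_smul] at h2
    have h3 : ⟪G (x + t • h), h⟫ - ⟪G x, h⟫ - t * ⟪A h, h⟫
        = ⟪G (x + t • h) - G x - t • A h, h⟫ := by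
      rw [inner_sub_left, inner_sub_left, inner_smul_left]; simp
    rw [h3]
    refine (norm_inner_le_norm _ _).trans ?_
    rw [norm_smul, Real.norm_of_nonneg ht.1] at h2
    have h4 : κ * (t * ‖h‖) ≤ κ * ‖h‖ := by
      have : t * ‖h‖ ≤ ‖h‖ := by nlinarith [norm_nonneg h, ht.2]
      gcongr
    nlinarith [norm_nonneg h]
  have := norm_image_sub_le_of_norm_deriv_le_segment_01' hd hb
  rw [Real.norm_eq_abs] at this
  refine le_of_eq_of_le ?_ this
  congr 1
  simp; ring

/-- Necessary conditions of first and second order when one function touches another one from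
below. -/
lemma gradient_eq_and_hessian_le {f₁ f₂ : F → ℝ} {G₁ G₂ : F → F} {A₁ A₂ : F →L[ℝ] F} {x : F}
    (hf₁ : ∀ᶠ y in 𝓝 x, HasGradientAt f₁ (G₁ y) y) (hG₁ : HasFDerivAt G₁ A₁ x)
    (hf₂ : ∀ᶠ y in 𝓝 x, HasGradientAt f₂ (G₂ y) y) (hG₂ : HasFDerivAt G₂ A₂ x)
    (hle : ∀ᶠ y in 𝓝 x, f₁ y - f₁ x ≤ f₂ y - f₂ x) :
    G₁ x = G₂ x ∧ ∀ w, ⟪A₁ w, w⟫ ≤ ⟪A₂ w, w⟫ := by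
  have := eq_zero_and_nonpos_of_quadratic_le (g := G₁ x - G₂ x) (A := A₁ - A₂) fun κ hκ => by
    obtain ⟨ρ₁, hρ₁, H₁⟩ := exists_taylor_two hf₁ hG₁ (half_pos hκ)
    obtain ⟨ρ₂, hρ₂, H₂⟩ := exists_taylor_two hf₂ hG₂ (half_pos hκ)
    obtain ⟨ρ₃, hρ₃, H₃⟩ := Metric.eventually_nhds_iff.1 hle
    refine ⟨min ρ₁ (min ρ₂ ρ₃), by positivity, fun w hw => ?_⟩
    simp only [lt_min_iff] at hw
    have e1 := abs_le.1 (H₁ w hw.1)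
    have e2 := abs_le.1 (H₂ w hw.2.1)
    have e3 := H₃ (y := x + w) (by simpa [dist_eq_norm] using hw.2.2)
    rw [inner_sub_left, sub_apply, inner_sub_left]
    linarith [e1.1, e2.2]
  refine ⟨sub_eq_zero.1 this.1, fun w => ?_⟩
  have := this.2 w
  rw [sub_apply, inner_sub_left] at this
  linarith

end SecondOrder

section Contact

variable {F : Type*} [NormedAddCommGroup F] [InnerProductSpace ℝ F] [FiniteDimensional ℝ F]

/-- If a difference of two Lipschitz maps inverts `Z` on a ball, then both maps are
differentiable at some point of the image of `Z`. -/
lemma exists_differentiableAt_of_rightInverse {q₁ q₂ Z : F → F} {K₁ K₂ : NNReal}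
    (h₁ : LipschitzWith K₁ q₁) (h₂ : LipschitzWith K₂ q₂) {δ : ℝ} (hδ : 0 < δ)
    (hZ : ∀ p, ‖p‖ < δ → q₁ (Z p) - q₂ (Z p) = p) :
    ∃ p, ‖p‖ < δ ∧ DifferentiableAt ℝ q₁ (Z p) ∧ DifferentiableAt ℝ q₂ (Z p) := by
  by_contra! hcon
  let _ : MeasurableSpace F := borel F
  have : BorelSpace F := ⟨rfl⟩
  set μ : Measure F := μH[Module.finrank ℝ F] with hμ
  have : μ.IsAddHaarMeasure := isAddHaarMeasure_hausdorffMeasure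
  have hae := (h₁.ae_differentiableAt (μ := μ)).and (h₂.ae_differentiableAt (μ := μ))
  set N := {z | ¬ (DifferentiableAt ℝ q₁ z ∧ DifferentiableAt ℝ q₂ z)} with hN
  have hN0 : μ N = 0 := hae
  have hsub : Metric.ball 0 δ ⊆ (fun z => q₁ z - q₂ z) '' N := by
    intro p hp
    have hp' : ‖p‖ < δ := by simpa using hp
    exact ⟨Z p, fun h => hcon p hp' h.1 h.2, hZ p hp'⟩
  have himg := (h₁.sub h₂).hausdorffMeasure_image_le (d := Module.finrank ℝ F) (by positivity) N
  rw [← hμ, hN0, mul_zero] at himg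
  have : μ (Metric.ball 0 δ) = 0 := le_antisymm ((measure_mono hsub).trans himg) bot_le
  exact (Metric.measure_ball_pos μ 0 hδ).ne' this

end Contact

section Doubling

variable {F : Type*} [NormedAddCommGroup F] [InnerProductSpace ℝ F]

lemma complete_square (k : ℝ) (hk : 0 < k) (a : ℝ) (g z z₀ : F) :
    a + ⟪g, z - z₀⟫ + k * ‖z - z₀‖ ^ 2 = (a - ‖g‖ ^ 2 / (4 * k)) +
      k * ‖z - (z₀ - (1 / (2 * k)) • g)‖ ^ 2 := by
  rw [show z - (z₀ - (1 / (2 * k)) • g) = (z - z₀) + (1 / (2 * k)) • g by abel, norm_add_sq_real,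
    inner_smul_right, norm_smul, real_inner_comm, Real.norm_of_nonneg (by positivity)]
  field_simp
  ring

lemma eq_zero_of_inner_le_sq {g : F} {C : ℝ} (h : ∀ w : F, ⟪g, w⟫ ≤ C * ‖w‖ ^ 2) : g = 0 := by
  refine (eq_zero_and_nonpos_of_quadratic_le (g := g)
    (A := (-(2 * C)) • ContinuousLinearMap.id ℝ F) fun κ hκ => ⟨1, one_pos, fun w _ => ?_⟩).1
  simp only [smul_apply, ContinuousLinearMap.id_apply, inner_smul_left,
    conj_trivial, real_inner_self_eq_norm_sq]
  nlinarith [h w, sq_nonneg ‖w‖]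

variable [FiniteDimensional ℝ F]

/-- Doubling of variables: for an arbitrarily small linear perturbation `p`, the penalized
difference `u x - v y - k / 2 * ‖x - y‖ ^ 2` has a maximum point at which `u` and `v` possess
ordered second order expansions from above and from below, respectively. -/
theorem exists_doubling {S : Set F} (hS : IsCompact S) (hne : S.Nonempty) {u v : F → ℝ}
    (hu : UpperSemicontinuousOn u S) (hv : LowerSemicontinuousOn v S) {k δ : ℝ} (hk : 0 < k)
    (hδ : 0 < δ) :
    ∃ (p x y q : F) (A B : F →L[ℝ] F), ‖p‖ < δ ∧ x ∈ S ∧ y ∈ S ∧ q = k • (x - y) + (1 / 2 : ℝ) • p ∧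
      (∀ x' ∈ S, ∀ y' ∈ S, u x' - v y' - k / 2 * ‖x' - y'‖ ^ 2 - 1 / 2 * ⟪p, x' + y'⟫ ≤
        u x - v y - k / 2 * ‖x - y‖ ^ 2 - 1 / 2 * ⟪p, x + y⟫) ∧
      (∀ κ > 0, ∃ ρ > 0, ∀ x' ∈ S, ‖x' - x‖ < ρ →
        u x' ≤ u x + ⟪q, x' - x⟫ + 1 / 2 * ⟪A (x' - x), x' - x⟫ + κ * ‖x' - x‖ ^ 2) ∧
      (∀ κ > 0, ∃ ρ > 0, ∀ y' ∈ S, ‖y' - y‖ < ρ →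
        v y + ⟪q - p, y' - y⟫ + 1 / 2 * ⟪B (y' - y), y' - y⟫ - κ * ‖y' - y‖ ^ 2 ≤ v y') ∧
      (∀ w, ⟪A w, w⟫ ≤ ⟪B w, w⟫) ∧ ‖A‖ ≤ 6 * k ∧ ‖B‖ ≤ 6 * k := by
  have hvn : UpperSemicontinuousOn (fun y => -v y) S := fun y hy c hc => by
    filter_upwards [hv y hy (-c) (by linarith)] with z hz
    linarith
  obtain ⟨U, qU, Uge, Ule, Uup, Ulo⟩ := exists_c11_envelope hS hne hu hk
  obtain ⟨W, qW, Wge, Wle, Wup, Wlo⟩ := exists_c11_envelope hS hne hvn hk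
  have hmax : ∀ p : F, ∃ x ∈ S, ∃ y ∈ S, ∀ x' ∈ S, ∀ y' ∈ S,
      u x' - v y' - k / 2 * ‖x' - y'‖ ^ 2 - 1 / 2 * ⟪p, x' + y'⟫ ≤
        u x - v y - k / 2 * ‖x - y‖ ^ 2 - 1 / 2 * ⟪p, x + y⟫ := by
    intro p
    have h1 : UpperSemicontinuousOn (fun a : F × F => u a.1) (S ×ˢ S) := fun a ha c hc =>
      (tendsto_fst (f := 𝓝[S] a.1) (g := 𝓝[S] a.2)).eventually (hu a.1 ha.1 c hc) |>.filter_mono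
        (by rw [nhdsWithin_prod_eq])
    have h2 : UpperSemicontinuousOn (fun a : F × F => -v a.2) (S ×ˢ S) := fun a ha c hc =>
      (tendsto_snd (f := 𝓝[S] a.1) (g := 𝓝[S] a.2)).eventually (hvn a.2 ha.2 c hc) |>.filter_mono
        (by rw [nhdsWithin_prod_eq])
    have h3 : UpperSemicontinuousOn
        (fun a : F × F => -(k / 2 * ‖a.1 - a.2‖ ^ 2) - 1 / 2 * ⟪p, a.1 + a.2⟫) (S ×ˢ S) :=
      (Continuous.upperSemicontinuous (by fun_prop)).upperSemicontinuousOn _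
    obtain ⟨a, ha, hamax⟩ := ((h1.add h2).add h3).exists_isMaxOn (hne.prod hne) (hS.prod hS)
    refine ⟨a.1, ha.1, a.2, ha.2, fun x' hx' y' hy' => ?_⟩
    have := isMaxOn_iff.1 hamax (x', y') ⟨hx', hy'⟩
    simp only at this
    linarith
  choose X hX Y hY hXY using hmax
  set Z : F → F := fun p => (1 / 2 : ℝ) • (X p + Y p) - (1 / (4 * k)) • p with hZdef
  -- the identity obtained by maximizing over the intermediate point
  have ident : ∀ p x y z : F, k * ‖x - z‖ ^ 2 + k * ‖y - z‖ ^ 2 + ⟪p, z⟫ =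
      k / 2 * ‖x - y‖ ^ 2 + 1 / 2 * ⟪p, x + y⟫ - ‖p‖ ^ 2 / (8 * k)
        + 2 * k * ‖z - ((1 / 2 : ℝ) • (x + y) - (1 / (4 * k)) • p)‖ ^ 2 := by
    intro p x y z
    have e1 : z - ((1 / 2 : ℝ) • (x + y) - (1 / (4 * k)) • p)
        = (z - (1 / 2 : ℝ) • (x + y)) + (1 / (4 * k)) • p := by abel
    have e2 := parallelogram_law_with_norm ℝ ((1 / 2 : ℝ) • (x - y)) (z - (1 / 2 : ℝ) • (x + y))
    rw [show (1 / 2 : ℝ) • (x - y) + (z - (1 / 2 : ℝ) • (x + y)) = -(y - z) by module,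
      show (1 / 2 : ℝ) • (x - y) - (z - (1 / 2 : ℝ) • (x + y)) = x - z by module, norm_neg,
      norm_smul] at e2
    rw [e1, norm_add_sq_real, norm_smul, inner_smul_right,
      real_inner_comm p (z - (1 / 2 : ℝ) • (x + y)), inner_sub_right, inner_smul_right,
      Real.norm_of_nonneg (by positivity : (0 : ℝ) ≤ 1 / (4 * k))]
    have e3 : ∀ N P R m : ℝ,
        2 * k * (N + 2 * (1 / (4 * k) * (P - 1 / 2 * R)) + (1 / (4 * k) * m) ^ 2)
        = 2 * k * N + (P - 1 / 2 * R) + m ^ 2 / (8 * k) := fun N P R m => by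
      field_simp
      ring
    rw [e3]
    rw [Real.norm_of_nonneg (by norm_num : (0 : ℝ) ≤ 1 / 2)] at e2
    linear_combination k * e2
  set c : F → ℝ := fun p => u (X p) - v (Y p) - k * ‖X p - Z p‖ ^ 2 - k * ‖Y p - Z p‖ ^ 2
    - ⟪p, Z p⟫ with hc
  have hM : ∀ p, ∀ x ∈ S, ∀ y ∈ S, ∀ z, u x - k * ‖x - z‖ ^ 2 + (-v y - k * ‖y - z‖ ^ 2)
      - ⟪p, z⟫ ≤ c p := by
    intro p x hx y hy z
    have e1 := ident p x y z
    have e2 := ident p (X p) (Y p) (Z p)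
    have e3 := hXY p x hx y hy
    have e4 : ‖Z p - ((1 / 2 : ℝ) • (X p + Y p) - (1 / (4 * k)) • p)‖ = 0 := by
      rw [hZdef]; simp
    rw [e4] at e2
    have e5 : 0 ≤ 2 * k * ‖z - ((1 / 2 : ℝ) • (x + y) - (1 / (4 * k)) • p)‖ ^ 2 := by positivity
    simp only [hc]
    nlinarith
  have Ule' : ∀ a g z₀, (∀ x ∈ S, ∀ z, u x - k * ‖x - z‖ ^ 2 ≤
      a + ⟪g, z - z₀⟫ + k * ‖z - z₀‖ ^ 2) → ∀ z, U z ≤ a + ⟪g, z - z₀⟫ + k * ‖z - z₀‖ ^ 2 := by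
    intro a g z₀ h z
    rw [complete_square k hk]
    exact Ule _ _ (fun x hx z => by rw [← complete_square k hk]; exact h x hx z) z
  have Wle' : ∀ a g z₀, (∀ y ∈ S, ∀ z, -v y - k * ‖y - z‖ ^ 2 ≤
      a + ⟪g, z - z₀⟫ + k * ‖z - z₀‖ ^ 2) → ∀ z, W z ≤ a + ⟪g, z - z₀⟫ + k * ‖z - z₀‖ ^ 2 := by
    intro a g z₀ h z
    rw [complete_square k hk]
    exact Wle _ _ (fun x hx z => by rw [← complete_square k hk]; exact h x hx z) z
  have hUW : ∀ p z, U z + W z - ⟪p, z⟫ ≤ c p := by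
    intro p z₀
    have s1 : ∀ y ∈ S, ∀ z, -v y - k * ‖y - z‖ ^ 2 ≤ c p + ⟪p, z⟫ - U z := by
      intro y hy z
      have := Ule' (v y + c p + ⟪p, y⟫) p y (fun x hx z => by
        have h1 := hM p x hx y hy z
        rw [inner_sub_right, norm_sub_rev z y]
        linarith) z
      rw [inner_sub_right, norm_sub_rev z y] at this
      linarith
    have := Wle' (c p + ⟪p, z₀⟫ - U z₀) (p - qU z₀) z₀ (fun y hy z => by
      have h1 := s1 y hy z
      have h2 := Ulo z₀ (z - z₀)
      rw [add_sub_cancel] at h2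
      rw [inner_sub_left, inner_sub_right p]
      linarith) z₀
    simp at this
    linarith
  have hUZ : ∀ p, U (Z p) = u (X p) - k * ‖X p - Z p‖ ^ 2 := fun p => by
    have h1 := hUW p (Z p)
    have h2 := Uge _ (hX p) (Z p)
    have h3 := Wge _ (hY p) (Z p)
    simp only [hc] at h1
    linarith
  have hWZ : ∀ p, W (Z p) = -v (Y p) - k * ‖Y p - Z p‖ ^ 2 := fun p => by
    have h1 := hUW p (Z p)
    have h2 := Uge _ (hX p) (Z p)
    have h3 := Wge _ (hY p) (Z p)
    simp only [hc] at h1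
    linarith
  have hmaxZ : ∀ p h, U (Z p + h) - U (Z p) + (W (Z p + h) - W (Z p)) ≤ ⟪p, h⟫ := fun p h => by
    have h1 := hUW p (Z p + h)
    have h2 := hUZ p
    have h3 := hWZ p
    simp only [hc] at h1
    rw [inner_add_right] at h1
    linarith
  have hgrad : ∀ p, qU (Z p) + qW (Z p) = p := fun p => by
    have := eq_zero_of_inner_le_sq (g := qU (Z p) + qW (Z p) - p) (C := 2 * k) fun w => by
      have h1 := hmaxZ p w
      have h2 := Ulo (Z p) w
      have h3 := Wlo (Z p) w
      rw [inner_sub_left, inner_add_left]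
      linarith
    exact sub_eq_zero.1 this
  have hqU : ∀ p, qU (Z p) = k • (X p - Y p) + (1 / 2 : ℝ) • p := fun p => by
    have := eq_zero_of_inner_le_sq (g := (2 * k) • (X p - Z p) - qU (Z p)) (C := 2 * k) fun w => by
      have h1 := Uge _ (hX p) (Z p + w)
      have h2 := Uup (Z p) w
      have h3 := hUZ p
      rw [← sub_sub, norm_sub_sq_real] at h1
      rw [inner_sub_left, inner_smul_left]
      simp only [conj_trivial]
      nlinarith
    rw [← sub_eq_zero.1 this]
    simp only [hZdef]
    have : (2 * k) * (1 / (4 * k)) = 1 / 2 := by field_simp; norm_num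
    rw [smul_sub, smul_sub, smul_smul (2 * k) (1 / (4 * k)) p, this]
    module
  have lipU : LipschitzWith (6 * k).toNNReal qU := by
    refine LipschitzWith.of_dist_le_mul fun a b => ?_
    rw [dist_eq_norm, dist_eq_norm, Real.coe_toNNReal _ (by positivity)]
    exact norm_gradient_sub_le_of_paraboloids Uup Ulo hk.le b a
  have lipW : LipschitzWith (6 * k).toNNReal qW := by
    refine LipschitzWith.of_dist_le_mul fun a b => ?_
    rw [dist_eq_norm, dist_eq_norm, Real.coe_toNNReal _ (by positivity)]
    exact norm_gradient_sub_le_of_paraboloids Wup Wlo hk.le b a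
  obtain ⟨p, hp, dU, dW⟩ := exists_differentiableAt_of_rightInverse lipU lipW.neg hδ (Z := Z)
    fun p _ => by simpa using hgrad p
  replace dW : DifferentiableAt ℝ qW (Z p) := by simpa using dW.neg
  have tU : ∀ {κ : ℝ}, 0 < κ → _ := fun hκ => exists_taylor_two
    (Eventually.of_forall fun z => hasGradientAt_of_paraboloids Uup Ulo z) dU.hasFDerivAt hκ
  have tW : ∀ {κ : ℝ}, 0 < κ → _ := fun hκ => exists_taylor_two
    (Eventually.of_forall fun z => hasGradientAt_of_paraboloids Wup Wlo z) dW.hasFDerivAt hκ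
  have hnU := norm_fderiv_le_of_lipschitz ℝ lipU (x₀ := Z p)
  have hnW := norm_fderiv_le_of_lipschitz ℝ lipW (x₀ := Z p)
  rw [Real.coe_toNNReal _ (by positivity)] at hnU hnW
  refine ⟨p, X p, Y p, qU (Z p), fderiv ℝ qU (Z p), -fderiv ℝ qW (Z p), hp, hX p, hY p, hqU p,
    hXY p, ?_, ?_, ?_, hnU, by rwa [norm_neg]⟩
  · intro κ hκ
    obtain ⟨ρ, hρ, H⟩ := tU hκ
    refine ⟨ρ, hρ, fun x hx hxρ => ?_⟩
    have h1 := (abs_le.1 (H _ hxρ)).2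
    have h2 := Uge x hx (Z p + (x - X p))
    rw [show x - (Z p + (x - X p)) = X p - Z p by abel] at h2
    linarith [hUZ p]
  · intro κ hκ
    obtain ⟨ρ, hρ, H⟩ := tW hκ
    refine ⟨ρ, hρ, fun y hy hyρ => ?_⟩
    have h1 := (abs_le.1 (H _ hyρ)).2
    have h2 := Wge y hy (Z p + (y - Y p))
    rw [show y - (Z p + (y - Y p)) = Y p - Z p by abel] at h2
    have h3 : qU (Z p) - p = -qW (Z p) := by
      rw [sub_eq_iff_eq_add, ← sub_eq_iff_eq_add', sub_neg_eq_add]; exact hgrad p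
    rw [h3, inner_neg_left, neg_apply, inner_neg_left]
    linarith [hWZ p]
  · intro w
    have := (eq_zero_and_nonpos_of_quadratic_le (g := 0)
      (A := fderiv ℝ qU (Z p) + fderiv ℝ qW (Z p)) fun κ hκ => ?_).2 w
    · rw [add_apply, inner_add_left] at this
      rw [neg_apply, inner_neg_left]
      linarith
    · obtain ⟨ρ₁, hρ₁, H₁⟩ := tU (half_pos hκ)
      obtain ⟨ρ₂, hρ₂, H₂⟩ := tW (half_pos hκ)
      refine ⟨min ρ₁ ρ₂, by positivity, fun w hw => ?_⟩
      rw [lt_min_iff] at hw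
      have h1 := (abs_le.1 (H₁ w hw.1)).1
      have h2 := (abs_le.1 (H₂ w hw.2)).1
      have h3 := hmaxZ p w
      have h4 : ⟪p, w⟫ = ⟪qU (Z p), w⟫ + ⟪qW (Z p), w⟫ := by rw [← inner_add_left, hgrad]
      rw [add_apply, inner_add_left, inner_zero_left]
      linarith

end Doubling

/-- The space-time in which the cylinder lives. -/
abbrev Spacetime (d : ℕ) : Type := ℝ × EuclideanSpace ℝ (Fin d)

/-- `φ` is of class `C^{1,2}` on the open set `U`, with time derivative `φt`, spatial gradient
`Dφ` and spatial Hessian `D2φ`. -/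
structure IsTest {d : ℕ} (U : Set (Spacetime d)) (φ φt : Spacetime d → ℝ)
    (Dφ : Spacetime d → EuclideanSpace ℝ (Fin d))
    (D2φ : Spacetime d → Matrix (Fin d) (Fin d) ℝ) : Prop where
  isOpen : IsOpen U
  cont : ContinuousOn φ U
  cont_time : ContinuousOn φt U
  cont_grad : ContinuousOn Dφ U
  cont_hess : ContinuousOn D2φ U
  deriv : ∀ q ∈ U,
      HasDerivAt (fun s => φ (s, q.2)) (φt q) q.1 ∧
      HasGradientAt (fun x => φ (q.1, x)) (Dφ q) q.2 ∧
      HasFDerivAt (fun x => Dφ (q.1, x)) (matCLM d (D2φ q)) q.2 ∧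
      (D2φ q).IsSymm

section Tests

variable {d : ℕ} {U V : Set (Spacetime d)} {φ φt ψ ψt : Spacetime d → ℝ}
  {Dφ Dψ : Spacetime d → EuclideanSpace ℝ (Fin d)}
  {D2φ D2ψ : Spacetime d → Matrix (Fin d) (Fin d) ℝ}

lemma matCLM_add (X Y : Matrix (Fin d) (Fin d) ℝ) : matCLM d (X + Y) = matCLM d X + matCLM d Y :=
  map_add (Matrix.toEuclideanCLM (n := Fin d) (𝕜 := ℝ)) X Y

lemma matCLM_neg (X : Matrix (Fin d) (Fin d) ℝ) : matCLM d (-X) = -matCLM d X :=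
  map_neg (Matrix.toEuclideanCLM (n := Fin d) (𝕜 := ℝ)) X

lemma matCLM_sub (X Y : Matrix (Fin d) (Fin d) ℝ) : matCLM d (X - Y) = matCLM d X - matCLM d Y :=
  map_sub (Matrix.toEuclideanCLM (n := Fin d) (𝕜 := ℝ)) X Y

lemma matCLM_smul (c : ℝ) (X : Matrix (Fin d) (Fin d) ℝ) : matCLM d (c • X) = c • matCLM d X :=
  map_smul (Matrix.toEuclideanCLM (n := Fin d) (𝕜 := ℝ)) c X

lemma matCLM_zero : matCLM d 0 = 0 :=
  map_zero (Matrix.toEuclideanCLM (n := Fin d) (𝕜 := ℝ))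

lemma matCLM_one : matCLM d 1 = 1 :=
  map_one (Matrix.toEuclideanCLM (n := Fin d) (𝕜 := ℝ))

lemma inner_matCLM_symm {X : Matrix (Fin d) (Fin d) ℝ} (hX : X.IsSymm)
    (v w : EuclideanSpace ℝ (Fin d)) : ⟪matCLM d X v, w⟫ = ⟪matCLM d X w, v⟫ := by
  have h : X.transpose = X := hX
  rw [real_inner_comm, real_inner_comm v, matCLM, Matrix.inner_toEuclideanCLM,
    Matrix.inner_toEuclideanCLM, Matrix.dotProduct_mulVec, ← Matrix.mulVec_transpose, h,
    dotProduct_comm]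

lemma posSemidef_sub_of_inner_le {X Y : Matrix (Fin d) (Fin d) ℝ} (hX : X.IsSymm) (hY : Y.IsSymm)
    (h : ∀ w, ⟪matCLM d X w, w⟫ ≤ ⟪matCLM d Y w, w⟫) : (Y - X).PosSemidef := by
  have hs : (Y - X).IsSymm := hY.sub hX
  refine Matrix.PosSemidef.of_dotProduct_mulVec_nonneg ?_ fun w => ?_
  · rw [Matrix.IsHermitian, Matrix.conjTranspose_eq_transpose_of_trivial]; exact hs
  · have h1 := h (WithLp.toLp 2 w)
    have h2 : ⟪matCLM d (Y - X) (WithLp.toLp 2 w), WithLp.toLp 2 w⟫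
        = w ⬝ᵥ (Y - X).mulVec w := by
      rw [real_inner_comm, matCLM, Matrix.inner_toEuclideanCLM]
    rw [star_trivial, ← h2, matCLM_sub, sub_apply, inner_sub_left]
    linarith

namespace IsTest

lemma mono (h : IsTest U φ φt Dφ D2φ) (hV : IsOpen V) (hVU : V ⊆ U) :
    IsTest V φ φt Dφ D2φ :=
  ⟨hV, h.cont.mono hVU, h.cont_time.mono hVU, h.cont_grad.mono hVU, h.cont_hess.mono hVU,
    fun q hq => h.deriv q (hVU hq)⟩

lemma add (h : IsTest U φ φt Dφ D2φ) (h' : IsTest V ψ ψt Dψ D2ψ) :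
    IsTest (U ∩ V) (φ + ψ) (φt + ψt) (Dφ + Dψ) (D2φ + D2ψ) := by
  have h1 := h.mono (h.isOpen.inter h'.isOpen) inter_subset_left
  have h2 := h'.mono (h.isOpen.inter h'.isOpen) inter_subset_right
  refine ⟨h1.isOpen, h1.cont.add h2.cont, h1.cont_time.add h2.cont_time,
    h1.cont_grad.add h2.cont_grad, h1.cont_hess.add h2.cont_hess, fun q hq => ?_⟩
  obtain ⟨a1, a2, a3, a4⟩ := h1.deriv q hq
  obtain ⟨b1, b2, b3, b4⟩ := h2.deriv q hq
  refine ⟨a1.add b1, ?_, ?_, a4.add b4⟩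
  · rw [hasGradientAt_iff_hasFDerivAt] at a2 b2 ⊢
    rw [Pi.add_apply, map_add]
    exact a2.add b2
  · rw [Pi.add_apply, matCLM_add]
    exact a3.add b3

lemma neg (h : IsTest U φ φt Dφ D2φ) : IsTest U (-φ) (-φt) (-Dφ) (-D2φ) := by
  refine ⟨h.isOpen, h.cont.neg, h.cont_time.neg, h.cont_grad.neg, h.cont_hess.neg,
    fun q hq => ?_⟩
  obtain ⟨a1, a2, a3, a4⟩ := h.deriv q hq
  refine ⟨a1.neg, ?_, ?_, a4.neg⟩
  · rw [hasGradientAt_iff_hasFDerivAt] at a2 ⊢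
    rw [Pi.neg_apply, map_neg]
    exact a2.neg
  · rw [Pi.neg_apply, matCLM_neg]
    exact a3.neg

/-- Products of a function of time and a function of space. -/
lemma mul_of_time_space {f f' : ℝ → ℝ} {G : EuclideanSpace ℝ (Fin d) → ℝ}
    {DG : EuclideanSpace ℝ (Fin d) → EuclideanSpace ℝ (Fin d)}
    {D2G : EuclideanSpace ℝ (Fin d) → Matrix (Fin d) (Fin d) ℝ}
    (hf : ∀ s, HasDerivAt f (f' s) s) (hf' : Continuous f') (hG : ∀ x, HasGradientAt G (DG x) x)
    (hDG : ∀ x, HasFDerivAt DG (matCLM d (D2G x)) x) (hD2G : Continuous D2G)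
    (hs : ∀ x, (D2G x).IsSymm) :
    IsTest univ (fun p : Spacetime d => f p.1 * G p.2) (fun p => f' p.1 * G p.2)
      (fun p => f p.1 • DG p.2) (fun p => f p.1 • D2G p.2) := by
  have cf : Continuous f := continuous_iff_continuousAt.2 fun s => (hf s).continuousAt
  have cG : Continuous G := continuous_iff_continuousAt.2 fun x =>
    (hG x).hasFDerivAt.continuousAt
  have cDG : Continuous DG := continuous_iff_continuousAt.2 fun x => (hDG x).continuousAt
  refine ⟨isOpen_univ, by fun_prop, by fun_prop, by fun_prop, ?_, fun q _ =>
    ⟨(hf q.1).mul_const (G q.2), ?_, ?_, (hs _).smul _⟩⟩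
  · exact ((cf.comp continuous_fst).smul (hD2G.comp continuous_snd)).continuousOn
  · have := hG q.2
    rw [hasGradientAt_iff_hasFDerivAt] at this ⊢
    rw [map_smul]
    exact this.const_mul (f q.1)
  · rw [matCLM_smul]
    exact (hDG q.2).const_smul (f q.1)

lemma quadratic (c b C : ℝ) (q : EuclideanSpace ℝ (Fin d)) {X : Matrix (Fin d) (Fin d) ℝ}
    (hX : X.IsSymm) (p₀ : Spacetime d) :
    IsTest univ
      (fun p => c + b * (p.1 - p₀.1) + C * (p.1 - p₀.1) ^ 2 + ⟪q, p.2 - p₀.2⟫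
        + 1 / 2 * ⟪matCLM d X (p.2 - p₀.2), p.2 - p₀.2⟫)
      (fun p => b + 2 * C * (p.1 - p₀.1)) (fun p => q + matCLM d X (p.2 - p₀.2)) fun _ => X := by
  refine ⟨isOpen_univ, ?_, ?_, ?_, continuousOn_const, fun p _ => ⟨?_, ?_, ?_, hX⟩⟩
  · exact Continuous.continuousOn (by fun_prop)
  · exact Continuous.continuousOn (by fun_prop)
  · exact Continuous.continuousOn (by fun_prop)
  · have h1 := (hasDerivAt_id p.1).sub_const p₀.1
    have := ((((h1.const_mul b).const_add c).add ((h1.pow 2).const_mul C)).add_const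
      ⟪q, p.2 - p₀.2⟫).add_const (1 / 2 * ⟪matCLM d X (p.2 - p₀.2), p.2 - p₀.2⟫)
    exact this.congr_deriv (by simp; ring)
  · rw [hasGradientAt_iff_hasFDerivAt]
    have h1 := (hasFDerivAt_id (𝕜 := ℝ) p.2).sub_const p₀.2
    have h2 := (matCLM d X).hasFDerivAt.comp p.2 h1
    have h3 := (((hasFDerivAt_const q p.2).inner ℝ h1).add ((h2.inner ℝ h1).const_mul
      (1 / 2 : ℝ))).const_add (c + b * (p.1 - p₀.1) + C * (p.1 - p₀.1) ^ 2)
    refine (h3.congr_fderiv ?_).congr_of_eventuallyEq (Eventually.of_forall fun x => ?_)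
    · ext w
      have := inner_matCLM_symm hX w (p.2 - p₀.2)
      simp [this, inner_sub_left]
      ring
    · simp; ring
  · have h1 := (hasFDerivAt_id (𝕜 := ℝ) p.2).sub_const p₀.2
    exact ((matCLM d X).hasFDerivAt.comp p.2 h1).const_add q

end IsTest

/-- Comparison of the derivatives of two test functions touching at a point of the cylinder. -/
lemma IsTest.touching {t₀ T₁ r : ℝ} (hφ : IsTest U φ φt Dφ D2φ) (hψ : IsTest V ψ ψt Dψ D2ψ)
    {p : Spacetime d} (hp : p ∈ cylQ d t₀ T₁ r) (hpU : p ∈ U) (hpV : p ∈ V) (heq : ψ p = φ p)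
    (hle : ∀ q ∈ U ∩ V ∩ cylQ d t₀ T₁ r, ψ q ≤ φ q) :
    ψt p ≤ φt p ∧ Dψ p = Dφ p ∧ (D2φ p - D2ψ p).PosSemidef := by
  have hO : IsOpen (U ∩ V) := hφ.isOpen.inter hψ.isOpen
  obtain ⟨a1, a2, a3, a4⟩ := hφ.deriv p hpU
  obtain ⟨b1, b2, b3, b4⟩ := hψ.deriv p hpV
  have hx : ∀ᶠ x in 𝓝 p.2, (p.1, x) ∈ U ∩ V := by
    have : ContinuousAt (fun x : EuclideanSpace ℝ (Fin d) => (p.1, x)) p.2 := by fun_prop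
    exact this.eventually_mem (hO.mem_nhds ⟨hpU, hpV⟩)
  have hs : ∀ᶠ s in 𝓝 p.1, (s, p.2) ∈ U ∩ V := by
    have : ContinuousAt (fun s : ℝ => (s, p.2)) p.1 := by fun_prop
    exact this.eventually_mem (hO.mem_nhds ⟨hpU, hpV⟩)
  have key := gradient_eq_and_hessian_le (f₁ := fun x => ψ (p.1, x)) (f₂ := fun x => φ (p.1, x))
    (G₁ := fun x => Dψ (p.1, x)) (G₂ := fun x => Dφ (p.1, x))
    (hx.mono fun x hx => (hψ.deriv _ hx.2).2.1) b3 (hx.mono fun x hx => (hφ.deriv _ hx.1).2.1) a3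
    (by
      filter_upwards [hx, Metric.isOpen_ball.mem_nhds hp.2] with x h1 h2
      have := hle (p.1, x) ⟨h1, hp.1, h2⟩
      simp only [Prod.mk.eta] at *
      linarith)
  refine ⟨?_, key.1, posSemidef_sub_of_inner_le b4 a4 key.2⟩
  have hd := ((a1.sub b1).hasDerivWithinAt (s := Ioi p.1))
  rw [hasDerivWithinAt_iff_tendsto_slope' (by simp)] at hd
  have : 0 ≤ φt p - ψt p := by
    refine ge_of_tendsto hd ?_
    filter_upwards [mem_nhdsWithin_of_mem_nhds hs, Ioo_mem_nhdsGT hp.1.2] with s h1 h2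
    have := hle (s, p.2) ⟨h1, ⟨hp.1.1.trans h2.1.le, h2.2⟩, hp.2⟩
    rw [slope_def_field]
    refine div_nonneg ?_ (by linarith [h2.1])
    simp only [Pi.sub_apply, Prod.mk.eta]
    linarith
  linarith

end Tests

/-- Continuity, boundedness at the origin, Lipschitz continuity and uniform ellipticity of the
nonlinearity. -/
structure IsElliptic (d : ℕ) (t₀ T₁ C₀ L₀ c₀ : ℝ)
    (g : ℝ → ℝ → EuclideanSpace ℝ (Fin d) → Matrix (Fin d) (Fin d) ℝ → ℝ) : Prop where
  cont : ContinuousOn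
      (fun q : ℝ × ℝ × EuclideanSpace ℝ (Fin d) × Matrix (Fin d) (Fin d) ℝ =>
        g q.1 q.2.1 q.2.2.1 q.2.2.2)
      (Set.Icc t₀ T₁ ×ˢ Set.univ ×ˢ Set.univ ×ˢ {γ : Matrix (Fin d) (Fin d) ℝ | γ.IsSymm})
  zero : ∀ s ∈ Set.Icc t₀ T₁, |g s 0 0 0| ≤ C₀
  lip : ∀ s ∈ Set.Icc t₀ T₁, ∀ (y y' : ℝ) (z z' : EuclideanSpace ℝ (Fin d))
      (γ γ' : Matrix (Fin d) (Fin d) ℝ), γ.IsSymm → γ'.IsSymm →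
      |g s y z γ - g s y' z' γ'| ≤ L₀ * (|y - y'| + ‖z - z'‖ + matNorm d (γ - γ'))
  ell : ∀ s ∈ Set.Icc t₀ T₁, ∀ (y : ℝ) (z : EuclideanSpace ℝ (Fin d))
      (γ₁ γ₂ : Matrix (Fin d) (Fin d) ℝ), γ₁.IsSymm → γ₂.IsSymm → (γ₁ - γ₂).PosSemidef →
      c₀ * (γ₁ - γ₂).trace ≤ g s y z γ₁ - g s y z γ₂

/-- The nonlinearity satisfied by the opposites of solutions. -/
def dualNonlinearity {d : ℕ}
    (g : ℝ → ℝ → EuclideanSpace ℝ (Fin d) → Matrix (Fin d) (Fin d) ℝ → ℝ) :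
    ℝ → ℝ → EuclideanSpace ℝ (Fin d) → Matrix (Fin d) (Fin d) ℝ → ℝ :=
  fun s y z γ => -g s (-y) (-z) (-γ)

section Viscosity

variable {d : ℕ} {t₀ T₁ r C₀ L₀ c₀ : ℝ}
  {g : ℝ → ℝ → EuclideanSpace ℝ (Fin d) → Matrix (Fin d) (Fin d) ℝ → ℝ}
  {U V : Set (Spacetime d)} {u v φ φt ψ ψt : Spacetime d → ℝ}
  {Dφ Dψ : Spacetime d → EuclideanSpace ℝ (Fin d)}
  {D2φ D2ψ : Spacetime d → Matrix (Fin d) (Fin d) ℝ} {Q : Set (Spacetime d)}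

lemma cylQ_fst_mem {p : Spacetime d} (hp : p ∈ cylQ d t₀ T₁ r) : p.1 ∈ Icc t₀ T₁ :=
  ⟨hp.1.1, hp.1.2.le⟩

lemma IsElliptic.mono (hg : IsElliptic d t₀ T₁ C₀ L₀ c₀ g) (hc₀ : 0 ≤ c₀) {s : ℝ}
    (hs : s ∈ Icc t₀ T₁) (y : ℝ) (z : EuclideanSpace ℝ (Fin d))
    {X Y : Matrix (Fin d) (Fin d) ℝ} (hX : X.IsSymm) (hY : Y.IsSymm) (h : (Y - X).PosSemidef) :
    g s y z X ≤ g s y z Y := by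
  have := hg.ell s hs y z Y X hY hX h
  have := mul_nonneg hc₀ h.trace_nonneg
  linarith

lemma IsElliptic.dual (hg : IsElliptic d t₀ T₁ C₀ L₀ c₀ g) :
    IsElliptic d t₀ T₁ C₀ L₀ c₀ (dualNonlinearity g) := by
  refine ⟨?_, fun s hs => ?_, fun s hs y y' z z' γ γ' hγ hγ' => ?_,
    fun s hs y z γ₁ γ₂ h₁ h₂ h => ?_⟩
  · refine (hg.cont.comp (f := fun q : ℝ × ℝ × EuclideanSpace ℝ (Fin d) ×
      Matrix (Fin d) (Fin d) ℝ => (q.1, -q.2.1, -q.2.2.1, -q.2.2.2)) ?_ ?_).neg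
    · exact Continuous.continuousOn (by fun_prop)
    · rintro ⟨s, y, z, γ⟩ ⟨h1, -, -, h2⟩
      exact ⟨h1, trivial, trivial, Matrix.IsSymm.neg h2⟩
  · simpa [dualNonlinearity] using hg.zero s hs
  · have := hg.lip s hs (-y') (-y) (-z') (-z) (-γ') (-γ) hγ'.neg hγ.neg
    simp only [dualNonlinearity, sub_neg_eq_add, neg_add_eq_sub] at this ⊢
    exact this
  · have := hg.ell s hs (-y) (-z) (-γ₂) (-γ₁) h₂.neg h₁.neg (by simpa [neg_add_eq_sub] using h)
    simp only [dualNonlinearity, sub_neg_eq_add, neg_add_eq_sub] at this ⊢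
    exact this

lemma ViscSubsolProp.le (hu : ViscSubsolProp d g Q u) (hφ : IsTest U φ φt Dφ D2φ)
    {p : Spacetime d} (hp : p ∈ Q) (hpU : p ∈ U) (heq : u p = φ p)
    (hle : ∀ q ∈ U ∩ Q, u q ≤ φ q) : -φt p - g p.1 (u p) (Dφ p) (D2φ p) ≤ 0 :=
  hu p hp φ φt Dφ D2φ U hφ.isOpen hpU hφ.cont hφ.cont_time hφ.cont_grad hφ.cont_hess hφ.deriv
    heq hle

lemma viscSubsolProp_of (h : ∀ p ∈ Q, ∀ (φ φt : Spacetime d → ℝ)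
    (Dφ : Spacetime d → EuclideanSpace ℝ (Fin d))
    (D2φ : Spacetime d → Matrix (Fin d) (Fin d) ℝ) (U : Set (Spacetime d)),
    IsTest U φ φt Dφ D2φ → p ∈ U → u p = φ p → (∀ q ∈ U ∩ Q, u q ≤ φ q) →
    -φt p - g p.1 (u p) (Dφ p) (D2φ p) ≤ 0) : ViscSubsolProp d g Q u :=
  fun p hp φ φt Dφ D2φ U h1 h2 h3 h4 h5 h6 h7 =>
    h p hp φ φt Dφ D2φ U ⟨h1, h3, h4, h5, h6, h7⟩ h2

lemma ViscSupersolProp.neg (hv : ViscSupersolProp d g Q v) :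
    ViscSubsolProp d (dualNonlinearity g) Q (-v) := by
  refine viscSubsolProp_of fun p hp φ φt Dφ D2φ U hφ hpU heq hle => ?_
  have hn := hφ.neg
  have := hv p hp (-φ) (-φt) (-Dφ) (-D2φ) U hn.isOpen hpU hn.cont hn.cont_time hn.cont_grad
    hn.cont_hess hn.deriv (by simp [← heq]) fun q hq => by
      have := hle q hq
      simp only [Pi.neg_apply] at this ⊢
      linarith
  simp only [Pi.neg_apply, dualNonlinearity, neg_neg] at this ⊢
  linarith

lemma ViscSubsolProp.neg (hu : ViscSubsolProp d (dualNonlinearity g) Q u) :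
    ViscSupersolProp d g Q (-u) := by
  intro p hp φ φt Dφ D2φ U h1 h2 h3 h4 h5 h6 h7 h8 h9
  have hn := (IsTest.mk h1 h3 h4 h5 h6 h7).neg
  have := hu.le hn hp h2 (by simp [← h8]) fun q hq => by
    have := h9 q hq
    simp only [Pi.neg_apply] at this ⊢
    linarith
  simp only [Pi.neg_apply, dualNonlinearity, neg_neg] at this ⊢
  linarith

lemma IsElliptic.le_of_touching (hg : IsElliptic d t₀ T₁ C₀ L₀ c₀ g) (hc₀ : 0 ≤ c₀)
    (hφ : IsTest U φ φt Dφ D2φ) (hψ : IsTest V ψ ψt Dψ D2ψ)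
    {p : Spacetime d} (hp : p ∈ cylQ d t₀ T₁ r) (hpU : p ∈ U) (hpV : p ∈ V) (heq : ψ p = φ p)
    (hle : ∀ q ∈ U ∩ V ∩ cylQ d t₀ T₁ r, ψ q ≤ φ q) :
    -φt p - g p.1 (φ p) (Dφ p) (D2φ p) ≤ -ψt p - g p.1 (ψ p) (Dψ p) (D2ψ p) := by
  obtain ⟨h1, h2, h3⟩ := hφ.touching hψ hp hpU hpV heq hle
  have := hg.mono hc₀ (cylQ_fst_mem hp) (φ p) (Dφ p) (hψ.deriv p hpV).2.2.2
    (hφ.deriv p hpU).2.2.2 h3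
  rw [heq, h2]
  linarith

lemma IsTest.viscSubsolProp (hψ : IsTest univ ψ ψt Dψ D2ψ)
    (hg : IsElliptic d t₀ T₁ C₀ L₀ c₀ g) (hc₀ : 0 ≤ c₀)
    (h : ∀ p ∈ cylQ d t₀ T₁ r, -ψt p - g p.1 (ψ p) (Dψ p) (D2ψ p) ≤ 0) :
    ViscSubsolProp d g (cylQ d t₀ T₁ r) ψ := by
  refine viscSubsolProp_of fun p hp φ φt Dφ D2φ U hφ hpU heq hle => ?_
  have := hg.le_of_touching hc₀ hφ hψ hp hpU (mem_univ p) heq fun q hq => hle q ⟨hq.1.1, hq.2⟩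
  rw [heq]
  exact this.trans (h p hp)

lemma matNorm_smul_one_le (κ : ℝ) : matNorm d (κ • 1) ≤ |κ| := by
  rw [matNorm, matCLM_smul, matCLM_one, norm_smul, Real.norm_eq_abs]
  exact mul_le_of_le_one_right (abs_nonneg κ) ContinuousLinearMap.norm_id_le

/-- The function `u - θ e^{(L₀ + 1)(T₁ - s)}` is a strict subsolution when `u` is a subsolution;
the inequality is tested against second order expansions. -/
lemma ViscSubsolProp.le_of_jet (hu : ViscSubsolProp d g (cylQ d t₀ T₁ r) u)
    (hg : IsElliptic d t₀ T₁ C₀ L₀ c₀ g) (hL₀ : 0 ≤ L₀) {θ : ℝ} (hθ : 0 ≤ θ) {w : Spacetime d → ℝ}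
    (hw : ∀ p, w p = u p - θ * Real.exp ((L₀ + 1) * (T₁ - p.1))) {p : Spacetime d}
    (hp : p ∈ cylQ d t₀ T₁ r) {b : ℝ} {q : EuclideanSpace ℝ (Fin d)}
    {X : Matrix (Fin d) (Fin d) ℝ} (hX : X.IsSymm)
    (hjet : ∀ κ > 0, ∃ C, ∃ ρ > 0, ∀ p' ∈ cylQ d t₀ T₁ r, dist p' p < ρ →
      w p' ≤ w p + b * (p'.1 - p.1) + ⟪q, p'.2 - p.2⟫
        + 1 / 2 * ⟪matCLM d X (p'.2 - p.2), p'.2 - p.2⟫ + κ * ‖p'.2 - p.2‖ ^ 2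
        + C * (p'.1 - p.1) ^ 2) :
    -b - g p.1 (w p) q X ≤ -θ := by
  have hs := cylQ_fst_mem hp
  have main : ∀ κ > 0, -b - g p.1 (w p) q X ≤ -θ + L₀ * (2 * κ) := by
    intro κ hκ
    obtain ⟨C, ρ, hρ, H⟩ := hjet κ hκ
    have hXκ : (X + (2 * κ) • (1 : Matrix (Fin d) (Fin d) ℝ)).IsSymm :=
      hX.add (Matrix.isSymm_one.smul _)
    have t1 := (IsTest.quadratic (w p) b C q hXκ p).mono (V := Metric.ball p ρ)
      Metric.isOpen_ball (subset_univ _)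
    have t2 := IsTest.mul_of_time_space (d := d)
      (f := fun s => θ * Real.exp ((L₀ + 1) * (T₁ - s)))
      (f' := fun s => -(L₀ + 1) * (θ * Real.exp ((L₀ + 1) * (T₁ - s))))
      (G := fun _ => 1) (DG := fun _ => 0) (D2G := fun _ => 0) (fun s => by
        have := ((((hasDerivAt_id s).const_sub T₁).const_mul (L₀ + 1)).exp).const_mul θ
        exact this.congr_deriv (by simp; ring)) (by fun_prop)
      (fun x => by rw [hasGradientAt_iff_hasFDerivAt, map_zero]; exact hasFDerivAt_const _ _)
      (fun x => by rw [matCLM_zero]; exact hasFDerivAt_const _ _) continuous_const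
      fun _ => Matrix.isSymm_zero
    have hp1 : p ∈ Metric.ball p ρ := Metric.mem_ball_self hρ
    have key := hu.le (t1.add t2) hp ⟨hp1, trivial⟩ (by simp [hw]) (by
      rintro p' ⟨⟨h1, -⟩, h2⟩
      have h3 := H p' h2 h1
      have h4 := hw p'
      simp only [Pi.add_apply, matCLM_add, matCLM_smul, matCLM_one, add_apply, smul_apply,
        one_apply_eq_self, inner_add_left, inner_smul_left,
        real_inner_self_eq_norm_sq, conj_trivial]
      linarith)
    simp only [Pi.add_apply, sub_self, mul_zero, add_zero, map_zero, smul_zero, mul_one] at key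
    have l1 := hg.lip p.1 hs (u p) (w p) q q (X + (2 * κ) • 1) X hXκ hX
    have l2 := (abs_le.1 l1).2
    have hE : 1 ≤ Real.exp ((L₀ + 1) * (T₁ - p.1)) :=
      Real.one_le_exp (mul_nonneg (by linarith) (by linarith [hs.2]))
    have l3 : u p - w p = θ * Real.exp ((L₀ + 1) * (T₁ - p.1)) := by rw [hw]; ring
    have l4 : matNorm d (X + (2 * κ) • 1 - X) ≤ 2 * κ := by
      rw [add_sub_cancel_left]
      exact (matNorm_smul_one_le _).trans (abs_of_pos (by positivity)).le
    rw [l3, abs_of_nonneg (by positivity), sub_self, norm_zero, add_zero] at l2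
    have l5 := mul_le_mul_of_nonneg_left l4 hL₀
    nlinarith
  have : ∀ ε > 0, -b - g p.1 (w p) q X ≤ -θ + ε := by
    intro ε hε
    have h1 := main (ε / (2 * (L₀ + 1))) (by positivity)
    have h2 : L₀ * (2 * (ε / (2 * (L₀ + 1)))) ≤ ε := by
      rw [show L₀ * (2 * (ε / (2 * (L₀ + 1)))) = L₀ * ε / (L₀ + 1) by field_simp,
        div_le_iff₀ (by positivity)]
      nlinarith
    linarith
  exact le_of_forall_pos_le_add this

end Viscosity

section ParabolicDoubling

variable {d : ℕ}

lemma exists_isSymm_inner_eq (T : EuclideanSpace ℝ (Fin d) →L[ℝ] EuclideanSpace ℝ (Fin d)) {K : ℝ}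
    (hT : ‖T‖ ≤ K) : ∃ X : Matrix (Fin d) (Fin d) ℝ, X.IsSymm ∧
      (∀ h, ⟪matCLM d X h, h⟫ = ⟪T h, h⟫) ∧ ∀ i j, |X i j| ≤ K := by
  obtain ⟨M, rfl⟩ : ∃ M, matCLM d M = T :=
    (Matrix.toEuclideanCLM (n := Fin d) (𝕜 := ℝ)).surjective T
  have hM : ∀ i j, |M i j| ≤ K := by
    intro i j
    have h1 : M i j = ⟪EuclideanSpace.single i (1 : ℝ),
        matCLM d M (EuclideanSpace.single j (1 : ℝ))⟫ := by
      rw [matCLM, Matrix.inner_toEuclideanCLM]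
      simp
    rw [h1]
    refine (abs_real_inner_le_norm _ _).trans ?_
    have := (matCLM d M).le_opNorm (EuclideanSpace.single j (1 : ℝ))
    simp only [PiLp.norm_single, norm_one, mul_one, one_mul] at this ⊢
    linarith
  refine ⟨(1 / 2 : ℝ) • (M + M.transpose), (Matrix.isSymm_add_transpose_self M).smul _, fun h => ?_,
    fun i j => ?_⟩
  · have h1 : ⟪matCLM d M.transpose h, h⟫ = ⟪matCLM d M h, h⟫ := by
      rw [real_inner_comm, real_inner_comm h, matCLM, matCLM, Matrix.inner_toEuclideanCLM,
        Matrix.inner_toEuclideanCLM, Matrix.dotProduct_mulVec, Matrix.vecMul_transpose,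
        dotProduct_comm]
    rw [matCLM_smul, matCLM_add, smul_apply, add_apply, inner_smul_left, inner_add_left, h1]
    simp
    ring
  · have h1 := abs_le.1 (hM i j)
    have h2 := abs_le.1 (hM j i)
    simp only [Matrix.smul_apply, Matrix.add_apply, Matrix.transpose_apply, smul_eq_mul]
    rw [abs_le]
    constructor <;> linarith [h1.1, h1.2, h2.1, h2.2]

/-- Rescaling of time, into a Euclidean space. -/
noncomputable def rescale (a : ℝ) (p : Spacetime d) : WithLp 2 (ℝ × EuclideanSpace ℝ (Fin d)) :=
  WithLp.toLp 2 (a * p.1, p.2)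

lemma rescale_sub (a : ℝ) (p p' : Spacetime d) :
    rescale a p - rescale a p' = rescale a (p - p') := by
  simp [rescale, ← WithLp.toLp_sub, mul_sub]

lemma inner_rescale (a : ℝ) (q : WithLp 2 (ℝ × EuclideanSpace ℝ (Fin d))) (p : Spacetime d) :
    ⟪q, rescale a p⟫ = a * q.fst * p.1 + ⟪q.snd, p.2⟫ := by
  rw [WithLp.prod_inner_apply]
  simp [rescale]
  ring

lemma norm_rescale_sq (a : ℝ) (p : Spacetime d) :
    ‖rescale a p‖ ^ 2 = a ^ 2 * p.1 ^ 2 + ‖p.2‖ ^ 2 := by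
  rw [WithLp.prod_norm_sq_eq_of_L2]
  simp [rescale, mul_pow]

lemma norm_rescale_le {a : ℝ} (ha : 0 ≤ a) (p : Spacetime d) :
    ‖rescale a p‖ ≤ a * |p.1| + ‖p.2‖ := by
  refine le_of_sq_le_sq ?_ (by positivity)
  rw [norm_rescale_sq, add_sq, mul_pow, sq_abs]
  have : 0 ≤ 2 * (a * |p.1|) * ‖p.2‖ := by positivity
  linarith

lemma continuous_rescale (a : ℝ) : Continuous (rescale (d := d) a) := by
  unfold rescale
  fun_prop

/-- The compression to the space variables of an operator on space-time, and the estimate of the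
associated quadratic form up to the time variable. -/
lemma exists_compression {a K : ℝ} (A : WithLp 2 (ℝ × EuclideanSpace ℝ (Fin d)) →L[ℝ]
    WithLp 2 (ℝ × EuclideanSpace ℝ (Fin d))) (hA : ‖A‖ ≤ K) :
    ∃ X : Matrix (Fin d) (Fin d) ℝ, X.IsSymm ∧
      (∀ h, ⟪matCLM d X h, h⟫ = ⟪A (rescale a (0, h)), rescale a (0, h)⟫) ∧
      (∀ i j, |X i j| ≤ K) ∧
      ∀ κ > 0, ∃ C, ∀ p : Spacetime d,
        |1 / 2 * ⟪A (rescale a p), rescale a p⟫ - 1 / 2 * ⟪matCLM d X p.2, p.2⟫| ≤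
          κ * ‖p.2‖ ^ 2 + C * p.1 ^ 2 := by
  set L := WithLp.prodContinuousLinearEquiv 2 ℝ ℝ (EuclideanSpace ℝ (Fin d)) with hL
  set ι : EuclideanSpace ℝ (Fin d) →L[ℝ] WithLp 2 (ℝ × EuclideanSpace ℝ (Fin d)) :=
    (L.symm : _ →L[ℝ] _) ∘L ContinuousLinearMap.inr ℝ ℝ _ with hι
  set π : WithLp 2 (ℝ × EuclideanSpace ℝ (Fin d)) →L[ℝ] EuclideanSpace ℝ (Fin d) :=
    ContinuousLinearMap.snd ℝ ℝ _ ∘L (L : _ →L[ℝ] _) with hπ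
  have eι : ∀ h, ι h = rescale a (0, h) := fun h => by
    simp [hι, hL, rescale]
  have nι : ∀ h, ‖ι h‖ = ‖h‖ := fun h => by
    rw [eι, ← sq_eq_sq₀ (norm_nonneg _) (norm_nonneg _), norm_rescale_sq]
    simp
  have nπ : ∀ f, ‖π f‖ ≤ ‖f‖ := fun f => by
    refine le_of_sq_le_sq ?_ (norm_nonneg _)
    rw [WithLp.prod_norm_sq_eq_of_L2]
    have : π f = f.snd := rfl
    rw [this]
    nlinarith [sq_nonneg ‖f.fst‖]
  have hK : 0 ≤ K := (norm_nonneg _).trans hA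
  have bA : ∀ f, ‖A f‖ ≤ K * ‖f‖ := fun f => A.le_of_opNorm_le hA f
  obtain ⟨X, X1, X2, X3⟩ := exists_isSymm_inner_eq (π ∘L A ∘L ι) (K := K) (by
    refine ContinuousLinearMap.opNorm_le_bound _ hK fun h => ?_
    exact (nπ _).trans ((bA _).trans (mul_le_mul_of_nonneg_left (nι h).le hK)))
  have hX : ∀ h, ⟪matCLM d X h, h⟫ = ⟪A (ι h), ι h⟫ := fun h => by
    rw [X2, eι h, inner_rescale, ← eι]
    simp [hπ, hL]
  refine ⟨X, X1, fun h => by rw [hX, eι], X3, fun κ hκ => ?_⟩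
  set e : WithLp 2 (ℝ × EuclideanSpace ℝ (Fin d)) := rescale a (1, 0) with he
  set m := K * ‖e‖ with hm
  have hm0 : 0 ≤ m := by positivity
  refine ⟨m ^ 2 / (4 * κ) + K * ‖e‖ ^ 2, fun p => ?_⟩
  have hp : rescale a p = p.1 • e + ι p.2 := by
    rw [eι, he]
    simp [rescale, ← WithLp.toLp_smul, ← WithLp.toLp_add, mul_comm]
  rw [hp, hX, map_add, map_smul, inner_add_left, inner_add_right, inner_add_right, inner_smul_left,
    inner_smul_left, inner_smul_right, inner_smul_right]
  simp only [conj_trivial]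
  have b1 := abs_le.1 ((abs_real_inner_le_norm (A e) e).trans
    (mul_le_mul_of_nonneg_right (bA e) (norm_nonneg _)))
  have b2 := (abs_real_inner_le_norm (A e) (ι p.2)).trans
    (mul_le_mul_of_nonneg_right (bA e) (norm_nonneg _))
  have b3 := (abs_real_inner_le_norm (A (ι p.2)) e).trans
    (mul_le_mul_of_nonneg_right (bA (ι p.2)) (norm_nonneg _))
  rw [nι] at b2 b3
  have c1 : |p.1 * (p.1 * ⟪A e, e⟫)| ≤ K * ‖e‖ ^ 2 * p.1 ^ 2 := by
    rw [← mul_assoc, ← pow_two, abs_mul, abs_of_nonneg (sq_nonneg p.1)]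
    have := abs_le.2 b1
    nlinarith [sq_nonneg p.1]
  have c2 : |p.1 * ⟪A e, ι p.2⟫| ≤ |p.1| * (m * ‖p.2‖) := by
    rw [abs_mul]
    exact mul_le_mul_of_nonneg_left b2 (abs_nonneg _)
  have c3 : |p.1 * ⟪A (ι p.2), e⟫| ≤ |p.1| * (m * ‖p.2‖) := by
    rw [abs_mul]
    exact mul_le_mul_of_nonneg_left (by rw [hm]; linarith) (abs_nonneg _)
  have c4 : |p.1| * (m * ‖p.2‖) ≤ κ * ‖p.2‖ ^ 2 + m ^ 2 / (4 * κ) * p.1 ^ 2 := by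
    have h1 : κ * ‖p.2‖ ^ 2 + m ^ 2 / (4 * κ) * p.1 ^ 2 - |p.1| * (m * ‖p.2‖)
        = κ * (‖p.2‖ - m * |p.1| / (2 * κ)) ^ 2 := by
      rw [← sq_abs p.1]
      field_simp
      ring
    have : 0 ≤ κ * (‖p.2‖ - m * |p.1| / (2 * κ)) ^ 2 := by positivity
    linarith
  have c5 : 0 ≤ K * ‖e‖ ^ 2 * p.1 ^ 2 := by positivity
  rw [abs_le] at c1 c2 c3 ⊢
  constructor <;> linarith [c1.1, c1.2, c2.1, c2.2, c3.1, c3.2]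

/-- Doubling of variables in space-time, with the second order expansions of the two functions
in parabolic form. -/
lemma exists_parabolic_doubling {S : Set (Spacetime d)} (hS : IsCompact S) {u v : Spacetime d → ℝ}
    (hu : UpperSemicontinuousOn u S) (hv : LowerSemicontinuousOn v S) {k δ a R : ℝ} (hk : 0 < k)
    (hδ : 0 < δ) (ha : 1 ≤ a) (hR : ∀ p ∈ S, a * |p.1| + ‖p.2‖ ≤ R) {p₀ : Spacetime d}
    (hp₀ : p₀ ∈ S) :
    ∃ (p p' : Spacetime d) (b b' : ℝ) (q q' : EuclideanSpace ℝ (Fin d))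
      (X Y : Matrix (Fin d) (Fin d) ℝ), p ∈ S ∧ p' ∈ S ∧ X.IsSymm ∧ Y.IsSymm ∧
      b - b' ≤ a * δ ∧ ‖q - q'‖ ≤ δ ∧ ‖q'‖ ≤ k * ‖p.2 - p'.2‖ + δ ∧
      u p₀ - v p₀ ≤ u p - v p' - k / 2 * (a ^ 2 * (p.1 - p'.1) ^ 2 + ‖p.2 - p'.2‖ ^ 2)
        + 2 * δ * R ∧
      (Y - X).PosSemidef ∧ (∀ i j, |Y i j| ≤ 6 * k) ∧
      (∀ κ > 0, ∃ C, ∃ ρ > 0, ∀ z ∈ S, dist z p < ρ →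
        u z ≤ u p + b * (z.1 - p.1) + ⟪q, z.2 - p.2⟫
        + 1 / 2 * ⟪matCLM d X (z.2 - p.2), z.2 - p.2⟫ + κ * ‖z.2 - p.2‖ ^ 2
        + C * (z.1 - p.1) ^ 2) ∧
      (∀ κ > 0, ∃ C, ∃ ρ > 0, ∀ z ∈ S, dist z p' < ρ →
        v p' + b' * (z.1 - p'.1) + ⟪q', z.2 - p'.2⟫
        + 1 / 2 * ⟪matCLM d Y (z.2 - p'.2), z.2 - p'.2⟫ - κ * ‖z.2 - p'.2‖ ^ 2
        - C * (z.1 - p'.1) ^ 2 ≤ v z) := by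
  have ha0 : 0 < a := by linarith
  set inv : WithLp 2 (ℝ × EuclideanSpace ℝ (Fin d)) → Spacetime d :=
    fun z => (a⁻¹ * z.fst, z.snd) with hinv
  have hleft : ∀ p, inv (rescale a p) = p := fun p => by
    simp [hinv, rescale, ha0.ne']
  have cinv : Continuous inv := by
    rw [hinv]
    fun_prop
  have hmaps : MapsTo inv (rescale a '' S) S := by
    rintro _ ⟨p, hp, rfl⟩
    rwa [hleft]
  obtain ⟨P, _, _, q, A, B, hP, ⟨p, hp, rfl⟩, ⟨p', hp', rfl⟩, hq, hmax, jA, jB, hAB, nA, nB⟩ :=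
    exists_doubling (hS.image (continuous_rescale a)) (⟨_, mem_image_of_mem _ hp₀⟩)
      (hu.comp cinv.continuousOn hmaps) (hv.comp cinv.continuousOn hmaps) hk hδ
  obtain ⟨X, X1, X2, -, X4⟩ := exists_compression (a := a) A nA
  obtain ⟨Y, Y1, Y2, Y3, Y4⟩ := exists_compression (a := a) B nB
  have hfst : ∀ z : WithLp 2 (ℝ × EuclideanSpace ℝ (Fin d)), |z.fst| ≤ ‖z‖ := fun z => by
    refine abs_le_of_sq_le_sq ?_ (norm_nonneg _)
    rw [WithLp.prod_norm_sq_eq_of_L2, Real.norm_eq_abs, sq_abs]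
    nlinarith [sq_nonneg ‖z.snd‖]
  have hsnd : ∀ z : WithLp 2 (ℝ × EuclideanSpace ℝ (Fin d)), ‖z.snd‖ ≤ ‖z‖ := fun z => by
    refine le_of_sq_le_sq ?_ (norm_nonneg _)
    rw [WithLp.prod_norm_sq_eq_of_L2]
    nlinarith [sq_nonneg ‖z.fst‖]
  have hlip : ∀ z z' : Spacetime d, ‖rescale a z - rescale a z'‖ ≤ 2 * a * dist z z' := by
    intro z z'
    rw [rescale_sub, dist_eq_norm]
    refine (norm_rescale_le ha0.le _).trans ?_
    have h1 : |(z - z').1| ≤ ‖z - z'‖ := norm_fst_le (z - z')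
    have h2 := norm_snd_le (z - z')
    nlinarith [norm_nonneg (z - z')]
  have hlip' : ∀ {ρ : ℝ} (z z' : Spacetime d), dist z z' < ρ / (2 * a) →
      ‖rescale a z - rescale a z'‖ < ρ := by
    intro ρ z z' h
    rw [lt_div_iff₀ (by positivity)] at h
    linarith [hlip z z']
  simp only [Function.comp_apply] at hmax jA jB
  refine ⟨p, p', a * q.fst, a * (q - P).fst, q.snd, (q - P).snd, X, Y, hp, hp', X1, Y1, ?_, ?_, ?_,
    ?_, posSemidef_sub_of_inner_le X1 Y1 fun w => by rw [X2, Y2]; exact hAB _, Y3, ?_, ?_⟩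
  · rw [← mul_sub, WithLp.sub_fst, sub_sub_cancel]
    exact mul_le_mul_of_nonneg_left ((le_abs_self _).trans ((hfst P).trans hP.le)) ha0.le
  · rw [WithLp.sub_snd, sub_sub_cancel]
    exact (hsnd P).trans hP.le
  · have h1 : (q - P).snd = k • (p.2 - p'.2) - (1 / 2 : ℝ) • P.snd := by
      rw [hq, rescale_sub, WithLp.sub_snd, WithLp.add_snd, WithLp.smul_snd, WithLp.smul_snd]
      have : (rescale a (p - p')).snd = p.2 - p'.2 := rfl
      rw [this]
      module
    rw [h1]
    refine (norm_sub_le _ _).trans ?_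
    rw [norm_smul, norm_smul, Real.norm_of_nonneg hk.le,
      Real.norm_of_nonneg (by norm_num : (0 : ℝ) ≤ 1 / 2)]
    linarith [hsnd P, norm_nonneg P]
  · have h1 := hmax _ (mem_image_of_mem _ hp₀) _ (mem_image_of_mem _ hp₀)
    rw [hleft, hleft, hleft, sub_self, rescale_sub, norm_rescale_sq] at h1
    have hb : ∀ z ∈ S, |⟪P, rescale a z⟫| ≤ δ * R := fun z hz => by
      refine (abs_real_inner_le_norm _ _).trans ?_
      exact mul_le_mul hP.le ((norm_rescale_le ha0.le z).trans (hR z hz)) (norm_nonneg _) hδ.le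
    have b1 := abs_le.1 (hb _ hp₀)
    have b2 := abs_le.1 (hb _ hp)
    have b3 := abs_le.1 (hb _ hp')
    simp only [norm_zero, inner_add_right, Prod.fst_sub, Prod.snd_sub] at h1
    linarith [b1.1, b1.2, b2.1, b2.2, b3.1, b3.2]
  · intro κ hκ
    obtain ⟨C, hC⟩ := X4 (κ / 4) (by positivity)
    obtain ⟨ρ, hρ, H⟩ := jA (κ / 4) (by positivity)
    refine ⟨C + κ / 4 * a ^ 2, ρ / (2 * a), by positivity, fun z hz hzρ => ?_⟩
    have h1 := H _ (mem_image_of_mem _ hz) (hlip' _ _ hzρ)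
    have h2 := (abs_le.1 (hC (z - p))).2
    rw [hleft, hleft, rescale_sub, inner_rescale, norm_rescale_sq] at h1
    simp only [Prod.fst_sub, Prod.snd_sub] at h1 h2
    nlinarith [sq_nonneg ‖z.2 - p.2‖]
  · intro κ hκ
    obtain ⟨C, hC⟩ := Y4 (κ / 4) (by positivity)
    obtain ⟨ρ, hρ, H⟩ := jB (κ / 4) (by positivity)
    refine ⟨C + κ / 4 * a ^ 2, ρ / (2 * a), by positivity, fun z hz hzρ => ?_⟩
    have h1 := H _ (mem_image_of_mem _ hz) (hlip' _ _ hzρ)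
    have h2 := (abs_le.1 (hC (z - p'))).1
    rw [hleft, hleft, rescale_sub, inner_rescale, norm_rescale_sq] at h1
    simp only [Prod.fst_sub, Prod.snd_sub] at h1 h2
    nlinarith [sq_nonneg ‖z.2 - p'.2‖]

end ParabolicDoubling

section Cylinder

variable {d : ℕ} {t₀ T₁ r : ℝ}

lemma cylQ_subset_cylQbar : cylQ d t₀ T₁ r ⊆ cylQbar d t₀ T₁ r :=
  prod_mono Ico_subset_Icc_self Metric.ball_subset_closedBall

lemma cylBdry_eq (h : t₀ ≤ T₁) : cylBdry d t₀ T₁ r =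
    (Icc t₀ T₁ ×ˢ Metric.sphere 0 r) ∪ ({T₁} ×ˢ Metric.closedBall 0 r) := by
  ext ⟨s, x⟩
  simp only [cylBdry, mem_union, mem_prod, mem_singleton_iff, Metric.mem_ball, Metric.mem_sphere,
    Metric.mem_closedBall, le_iff_lt_or_eq (b := r)]
  constructor
  · rintro (h1 | h1)
    · exact Or.inl h1
    · exact Or.inr ⟨h1.1, Or.inl h1.2⟩
  · rintro (h1 | ⟨rfl, h1 | h1⟩)
    · exact Or.inl h1
    · exact Or.inr ⟨rfl, h1⟩
    · exact Or.inl ⟨right_mem_Icc.2 h, h1⟩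

lemma cylBdry_subset_cylQbar (h : t₀ ≤ T₁) : cylBdry d t₀ T₁ r ⊆ cylQbar d t₀ T₁ r := by
  rw [cylBdry_eq h]
  refine union_subset (prod_mono_right Metric.sphere_subset_closedBall) (prod_mono_left ?_)
  exact singleton_subset_iff.2 (right_mem_Icc.2 h)

lemma isClosed_cylBdry (h : t₀ ≤ T₁) : IsClosed (cylBdry d t₀ T₁ r) := by
  rw [cylBdry_eq h]
  exact (isClosed_Icc.prod Metric.isClosed_sphere).union
    (isClosed_singleton.prod Metric.isClosed_closedBall)

lemma isCompact_cylQbar : IsCompact (cylQbar d t₀ T₁ r) :=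
  isCompact_Icc.prod (isCompact_closedBall 0 r)

lemma mem_cylQ_of_notMem_cylBdry {p : Spacetime d} (hp : p ∈ cylQbar d t₀ T₁ r)
    (hp' : p ∉ cylBdry d t₀ T₁ r) : p ∈ cylQ d t₀ T₁ r := by
  have h1 : p.2 ∈ Metric.ball 0 r := by
    by_contra h
    refine hp' (Or.inl ⟨hp.1, ?_⟩)
    have := hp.2
    simp only [Metric.mem_closedBall, Metric.mem_ball, Metric.mem_sphere] at *
    linarith
  refine ⟨⟨hp.1.1, lt_of_le_of_ne hp.1.2 fun h => hp' (Or.inr ⟨h, h1⟩)⟩, h1⟩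

lemma notMem_cylBdry {p : Spacetime d} (hp : p ∈ cylQ d t₀ T₁ r) : p ∉ cylBdry d t₀ T₁ r := by
  rintro (h | h)
  · exact (mem_ball_zero_iff.1 hp.2).ne (mem_sphere_zero_iff_norm.1 h.2)
  · exact hp.1.2.ne h.1

end Cylinder

section Compactness

/-- Strict bounds on the diagonal extend to a neighbourhood of it. -/
lemma exists_dist_lt_of_diagonal {α : Type*} [PseudoMetricSpace α] {K : Set α} (hK : IsCompact K)
    {D : Set (α × α)} (hD : IsClosed D) {u v : α → ℝ} (hu : UpperSemicontinuousOn u K)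
    (hv : LowerSemicontinuousOn v K) {c : ℝ}
    (h : ∀ z ∈ K, ∀ z' ∈ K, dist z z' = 0 → (z, z') ∈ D → u z - v z' < c) :
    ∃ ρ > 0, ∀ z ∈ K, ∀ z' ∈ K, (z, z') ∈ D → dist z z' < ρ → u z - v z' < c := by
  have hf : UpperSemicontinuousOn (fun a : α × α => u a.1 + -v a.2) (K ×ˢ K ∩ D) := by
    have h1 : UpperSemicontinuousOn (fun a : α × α => u a.1) (K ×ˢ K ∩ D) :=
      hu.comp continuous_fst.continuousOn fun a ha => ha.1.1
    have h2 : UpperSemicontinuousOn (fun a : α × α => -v a.2) (K ×ˢ K ∩ D) :=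
      (continuous_neg.comp_lowerSemicontinuousOn_antitone hv fun _ _ => neg_le_neg).comp
        continuous_snd.continuousOn fun a ha => ha.1.2
    exact h1.add h2
  have hc := hf.isCompact_inter_preimage_Ici ((hK.prod hK).inter_right hD) c
  rcases eq_empty_or_nonempty (K ×ˢ K ∩ D ∩ (fun a : α × α => u a.1 + -v a.2) ⁻¹' Ici c)
    with h0 | h0
  · refine ⟨1, one_pos, fun z hz z' hz' hzD _ => ?_⟩
    by_contra! hcon
    have : (z, z') ∈ (∅ : Set (α × α)) :=
      h0 ▸ ⟨⟨⟨hz, hz'⟩, hzD⟩, show c ≤ u z + -v z' by linarith⟩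
    exact this
  · obtain ⟨a, ha, hmin⟩ := hc.exists_isMinOn h0 (f := fun a => dist a.1 a.2)
      continuous_dist.continuousOn
    refine ⟨dist a.1 a.2, ?_, fun z hz z' hz' hzD hd => ?_⟩
    · refine lt_of_le_of_ne dist_nonneg fun h1 => ?_
      have h2 := h a.1 ha.1.1.1 a.2 ha.1.1.2 h1.symm ha.1.2
      have h3 : c ≤ u a.1 + -v a.2 := ha.2
      linarith
    · by_contra! hcon
      have := isMinOn_iff.1 hmin (z, z')
        ⟨⟨⟨hz, hz'⟩, hzD⟩, show c ≤ u z + -v z' by linarith⟩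
      simp only at this
      linarith

lemma exists_modulus_of_continuousOn {β : Type*} [PseudoMetricSpace β] {I : Set ℝ} {K : Set β}
    (hI : IsCompact I) (hK : IsCompact K) {f : ℝ × β → ℝ} (hf : ContinuousOn f (I ×ˢ K)) {ε : ℝ}
    (hε : 0 < ε) : ∃ ρ > 0, ∀ s ∈ I, ∀ s' ∈ I, |s - s'| < ρ → ∀ y ∈ K,
      |f (s, y) - f (s', y)| < ε := by
  have := (hI.prod hK).uniformContinuousOn_of_continuous hf
  obtain ⟨ρ, hρ, H⟩ := Metric.uniformContinuousOn_iff.1 this ε hε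
  refine ⟨ρ, hρ, fun s hs s' hs' h y hy => ?_⟩
  have := H (s, y) ⟨hs, hy⟩ (s', y) ⟨hs', hy⟩ (by simpa [Prod.dist_eq, Real.dist_eq, hρ] using h)
  rwa [Real.dist_eq] at this

variable {d : ℕ} {t₀ T₁ C₀ L₀ c₀ : ℝ}
  {g : ℝ → ℝ → EuclideanSpace ℝ (Fin d) → Matrix (Fin d) (Fin d) ℝ → ℝ}

lemma IsElliptic.exists_modulus (hg : IsElliptic d t₀ T₁ C₀ L₀ c₀ g) (K : ℝ) {ε : ℝ} (hε : 0 < ε) :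
    ∃ ρ > 0, ∀ s ∈ Icc t₀ T₁, ∀ s' ∈ Icc t₀ T₁, |s - s'| < ρ → ∀ (y : ℝ)
      (z : EuclideanSpace ℝ (Fin d)) (γ : Matrix (Fin d) (Fin d) ℝ), |y| ≤ K → ‖z‖ ≤ K →
      γ.IsSymm → (∀ i j, |γ i j| ≤ K) → |g s y z γ - g s' y z γ| < ε := by
  set G : Set (Fin d → Fin d → ℝ) := {γ | Matrix.IsSymm (γ : Matrix (Fin d) (Fin d) ℝ)} with hG
  have hGc : IsClosed G := by
    have : Continuous fun γ : Fin d → Fin d → ℝ => Matrix.transpose γ :=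
      Continuous.matrix_transpose continuous_id
    exact isClosed_eq this continuous_id
  have hB : IsCompact ((univ.pi fun _ => univ.pi fun _ => Icc (-K) K) ∩ G :
      Set (Fin d → Fin d → ℝ)) :=
    (isCompact_univ_pi fun _ => isCompact_univ_pi fun _ => isCompact_Icc).inter_right hGc
  obtain ⟨ρ, hρ, H⟩ := exists_modulus_of_continuousOn
    (β := ℝ × EuclideanSpace ℝ (Fin d) × (Fin d → Fin d → ℝ)) (I := Icc t₀ T₁)
    (K := Icc (-K) K ×ˢ Metric.closedBall 0 K ×ˢ
      ((univ.pi fun _ => univ.pi fun _ => Icc (-K) K) ∩ G))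
    (f := fun q => g q.1 q.2.1 q.2.2.1 q.2.2.2) isCompact_Icc
    (isCompact_Icc.prod ((isCompact_closedBall 0 K).prod hB))
    (hg.cont.mono fun q hq => ⟨hq.1, trivial, trivial, hq.2.2.2.2⟩) hε
  refine ⟨ρ, hρ, fun s hs s' hs' h y z γ hy hz hγ hγK => H s hs s' hs' h (y, z, γ)
    ⟨abs_le.1 hy, mem_closedBall_zero_iff.2 hz, ⟨fun i _ j _ => abs_le.1 (hγK i j), hγ⟩⟩⟩

end Compactness

section Comparison

variable {d : ℕ} {t₀ T₁ r C₀ L₀ c₀ : ℝ}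
  {g : ℝ → ℝ → EuclideanSpace ℝ (Fin d) → Matrix (Fin d) (Fin d) ℝ → ℝ} {u v : Spacetime d → ℝ}

set_option maxHeartbeats 1000000 in
/-- The comparison principle. -/
theorem comparison_principle (hT : t₀ ≤ T₁) (hg : IsElliptic d t₀ T₁ C₀ L₀ c₀ g) (hL₀ : 0 ≤ L₀)
    (hc₀ : 0 ≤ c₀) (hu : UpperSemicontinuousOn u (cylQbar d t₀ T₁ r))
    (hub : ∃ M, ∀ p ∈ cylQbar d t₀ T₁ r, |u p| ≤ M) (hus : ViscSubsolProp d g (cylQ d t₀ T₁ r) u)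
    (hv : LowerSemicontinuousOn v (cylQbar d t₀ T₁ r))
    (hvb : ∃ M, ∀ p ∈ cylQbar d t₀ T₁ r, |v p| ≤ M)
    (hvs : ViscSupersolProp d g (cylQ d t₀ T₁ r) v) (hle : ∀ p ∈ cylBdry d t₀ T₁ r, u p ≤ v p) :
    ∀ p ∈ cylQbar d t₀ T₁ r, u p ≤ v p := by
  obtain ⟨Mu, hMu⟩ := hub
  obtain ⟨Mv, hMv⟩ := hvb
  by_contra! hcon
  obtain ⟨p₁, hp₁, hlt⟩ := hcon
  set S := cylQbar d t₀ T₁ r with hS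
  set E : Spacetime d → ℝ := fun p => Real.exp ((L₀ + 1) * (T₁ - p.1)) with hE
  have hE1 : ∀ p ∈ S, 1 ≤ E p := fun p hp =>
    Real.one_le_exp (mul_nonneg (by linarith) (by linarith [hp.1.2]))
  have cE : Continuous E := by rw [hE]; fun_prop
  -- the largest relative gap
  set A : Set ℝ := (fun p => (u p - v p) / E p) '' S with hA
  have hAb : BddAbove A := by
    refine ⟨Mu + Mv, ?_⟩
    rintro _ ⟨p, hp, rfl⟩
    have h1 := abs_le.1 (hMu p hp)
    have h2 := abs_le.1 (hMv p hp)
    have h3 := hE1 p hp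
    rw [div_le_iff₀ (by linarith)]
    nlinarith [h1.2, h2.1, h1.1, h2.2]
  set θ := sSup A with hθdef
  have hθ : 0 < θ := lt_of_lt_of_le (div_pos (by linarith) (by linarith [hE1 p₁ hp₁]))
    (le_csSup hAb ⟨p₁, hp₁, rfl⟩)
  set w : Spacetime d → ℝ := fun p => v p + θ * E p with hw
  have huw : ∀ p ∈ S, u p ≤ w p := fun p hp => by
    have h1 := le_csSup hAb ⟨p, hp, rfl⟩
    have h2 := hE1 p hp
    rw [div_le_iff₀ (by linarith)] at h1
    simp only [hw]
    linarith
  have hwl : LowerSemicontinuousOn w S :=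
    hv.add ((Continuous.lowerSemicontinuous (by fun_prop)).lowerSemicontinuousOn _)
  obtain ⟨ME, hME⟩ := isCompact_cylQbar.exists_bound_of_continuousOn (cE.continuousOn (s := S))
  have hMw : ∀ p ∈ S, |w p| ≤ Mv + θ * ME := fun p hp => by
    refine (abs_add_le _ _).trans (add_le_add (hMv p hp) ?_)
    rw [abs_mul, abs_of_pos hθ]
    exact mul_le_mul_of_nonneg_left (hME p hp) hθ.le
  set M := Mu + (Mv + θ * ME) with hM
  have hM0 : 0 ≤ M := add_nonneg ((abs_nonneg _).trans (hMu p₁ hp₁))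
    ((abs_nonneg _).trans (hMw p₁ hp₁))
  set σ := θ / (8 * (L₀ + 1)) with hσ
  have hσ0 : 0 < σ := by positivity
  have hLσ : L₀ * σ ≤ θ / 8 := by
    have : (L₀ + 1) * σ = θ / 8 := by rw [hσ]; field_simp
    linarith
  have hσθ : σ ≤ θ / 8 := by
    rw [hσ]
    exact div_le_div_of_nonneg_left hθ.le (by norm_num) (by linarith)
  have hME1 : 1 ≤ ME := (hE1 p₁ hp₁).trans ((le_abs_self _).trans (hME p₁ hp₁))
  -- an almost maximum point
  obtain ⟨p₀, hp₀, hp₀θ⟩ : ∃ p₀ ∈ S, -(σ / 2) ≤ u p₀ - w p₀ := by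
    obtain ⟨_, ⟨p, hp, rfl⟩, h1⟩ := exists_lt_of_lt_csSup (s := A) ⟨_, p₁, hp₁, rfl⟩
      (show θ - σ / (2 * ME) < θ by have : 0 < σ / (2 * ME) := by positivity
                                    linarith)
    refine ⟨p, hp, ?_⟩
    have h2 := hE1 p hp
    have h3 : E p ≤ ME := (le_abs_self _).trans (hME p hp)
    rw [lt_div_iff₀ (by linarith)] at h1
    have h4 : σ / (2 * ME) * E p ≤ σ / 2 := by
      rw [div_mul_eq_mul_div, div_le_iff₀ (by positivity)]
      nlinarith
    simp only [hw]
    linarith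
  -- separation from the boundary
  obtain ⟨ρ₁, hρ₁, H₁⟩ := exists_dist_lt_of_diagonal isCompact_cylQbar isClosed_univ hu hwl (c := σ)
    fun z hz z' hz' h0 _ => by
      rw [dist_eq_zero.1 h0]
      linarith [huw z' hz']
  have hbd : ∀ p ∈ cylBdry d t₀ T₁ r, u p - w p < -(θ / 2) := fun p hp => by
    have h1 := hE1 p (cylBdry_subset_cylQbar hT hp)
    have h2 := hle p hp
    simp only [hw]
    nlinarith
  obtain ⟨ρ₂, hρ₂, H₂⟩ := exists_dist_lt_of_diagonal isCompact_cylQbar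
    (((isClosed_cylBdry (d := d) (r := r) hT).preimage continuous_fst).union
      ((isClosed_cylBdry (d := d) (r := r) hT).preimage continuous_snd)) hu hwl (c := -(θ / 2))
    fun z hz z' hz' h0 h1 => by
      obtain rfl := dist_eq_zero.1 h0
      exact hbd z (h1.elim id id)
  -- the choice of the parameters
  set ρ := min ρ₁ ρ₂ with hρ
  have hρ0 : 0 < ρ := lt_min hρ₁ hρ₂
  set k := 2 * (M + σ) / ρ ^ 2 + 1 with hk
  have hk0 : 0 < k := by positivity
  have hkρ : 2 * (M + σ) < k * ρ ^ 2 := by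
    rw [hk, add_mul, div_mul_cancel₀ _ (by positivity)]
    nlinarith
  obtain ⟨ρ₃, hρ₃, H₃⟩ := hg.exists_modulus (max (Mv + θ * ME) (max (k * ρ + 1) (6 * k)))
    (ε := θ / 8) (by positivity)
  set ρ' := min ρ ρ₃ with hρ'
  have hρ'0 : 0 < ρ' := lt_min hρ0 hρ₃
  obtain ⟨a, ha1, haρ⟩ : ∃ a : ℝ, 1 ≤ a ∧ 2 * (M + σ) < k * (a ^ 2 * ρ' ^ 2) := by
    refine ⟨ρ / ρ', ?_, ?_⟩
    · rw [le_div_iff₀ hρ'0, one_mul]; exact min_le_left _ _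
    · rwa [← mul_pow, div_mul_cancel₀ _ hρ'0.ne']
  obtain ⟨R, hR0, hR⟩ : ∃ R > 0, ∀ p ∈ S, a * |p.1| + ‖p.2‖ ≤ R := by
    obtain ⟨R, hR⟩ := isCompact_cylQbar.exists_bound_of_continuousOn
      (s := S) (f := fun p : Spacetime d => a * |p.1| + ‖p.2‖) (by fun_prop)
    exact ⟨max R 1, by positivity, fun p hp => (le_abs_self _).trans
      ((hR p hp).trans (le_max_left _ _))⟩
  set δ := min 1 (min (σ / (4 * R)) (min (θ / (8 * a)) σ)) with hδ
  have ha0 : 0 < a := by linarith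
  have hδ0 : 0 < δ := by positivity
  have hδ1 : δ ≤ 1 := min_le_left _ _
  have hδR : 2 * δ * R ≤ σ / 2 := by
    have : δ ≤ σ / (4 * R) := (min_le_right _ _).trans (min_le_left _ _)
    rw [le_div_iff₀ (by positivity)] at this
    linarith
  have hδa : a * δ ≤ θ / 8 := by
    have : δ ≤ θ / (8 * a) := (min_le_right _ _).trans ((min_le_right _ _).trans (min_le_left _ _))
    rw [le_div_iff₀ (by positivity)] at this
    linarith
  have hδσ : δ ≤ σ := (min_le_right _ _).trans ((min_le_right _ _).trans (min_le_right _ _))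
  obtain ⟨p, p', b, b', q, q', X, Y, hp, hp', hX, hY, hbb, hqq, hq', hmax, hXY, hYk, jX, jY⟩ :=
    exists_parabolic_doubling isCompact_cylQbar hu hwl hk0 hδ0 ha1 hR hp₀
  have m1 : u p - w p' ≤ M := by
    linarith [(abs_le.1 (hMu p hp)).2, (abs_le.1 (hMw p' hp')).1]
  have m2 : k * (a ^ 2 * (p.1 - p'.1) ^ 2 + ‖p.2 - p'.2‖ ^ 2) ≤ 2 * (M + σ) := by linarith
  have mx : ‖p.2 - p'.2‖ < ρ := by
    refine lt_of_pow_lt_pow_left₀ 2 hρ0.le (lt_of_mul_lt_mul_left ?_ hk0.le)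
    have : 0 ≤ k * (a ^ 2 * (p.1 - p'.1) ^ 2) := by positivity
    linarith
  have ms : |p.1 - p'.1| < ρ' := by
    refine lt_of_pow_lt_pow_left₀ 2 hρ'0.le (lt_of_mul_lt_mul_left (a := k * a ^ 2) ?_
      (by positivity))
    rw [sq_abs]
    have : 0 ≤ k * ‖p.2 - p'.2‖ ^ 2 := by positivity
    linarith
  have hdist : dist p p' < ρ := by
    rw [Prod.dist_eq, dist_eq_norm, dist_eq_norm]
    exact max_lt (ms.trans_le (min_le_left _ _)) mx
  have m3 : -σ ≤ u p - w p' := by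
    have : 0 ≤ k / 2 * (a ^ 2 * (p.1 - p'.1) ^ 2 + ‖p.2 - p'.2‖ ^ 2) := by positivity
    linarith
  have hnot : ¬ (p ∈ cylBdry d t₀ T₁ r ∨ p' ∈ cylBdry d t₀ T₁ r) := fun h => by
    have := H₂ p hp p' hp' h (hdist.trans_le (min_le_right _ _))
    linarith
  push Not at hnot
  have hpQ := mem_cylQ_of_notMem_cylBdry hp hnot.1
  have hpQ' := mem_cylQ_of_notMem_cylBdry hp' hnot.2
  have m4 := H₁ p hp p' hp' trivial (hdist.trans_le (min_le_left _ _))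
  have e1 := hus.le_of_jet hg hL₀ le_rfl (w := u) (by simp) hpQ hX (b := b) (q := q)
    fun κ hκ => by
      obtain ⟨C, ρ, hρ, H⟩ := jX κ hκ
      exact ⟨C, ρ, hρ, fun z hz => H z (cylQ_subset_cylQbar hz)⟩
  have e2 := hvs.neg.le_of_jet hg.dual hL₀ hθ.le (w := -w) (fun z => by
      simp only [Pi.neg_apply, hw, hE]; ring) hpQ' hY.neg (b := -b') (q := -q')
    fun κ hκ => by
      obtain ⟨C, ρ, hρ, H⟩ := jY κ hκ
      refine ⟨C, ρ, hρ, fun z hz hzρ => ?_⟩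
      have := H z (cylQ_subset_cylQbar hz) hzρ
      rw [matCLM_neg, neg_apply, inner_neg_left, inner_neg_left, Pi.neg_apply, Pi.neg_apply]
      linarith
  simp only [dualNonlinearity, Pi.neg_apply, neg_neg] at e2
  have f1 := hg.mono hc₀ hp.1 (u p) q hX hY hXY
  have f2 := (abs_le.1 (hg.lip p.1 hp.1 (u p) (w p') q q' Y Y hY hY)).2
  have f3 := (abs_lt.1 (H₃ p.1 hp.1 p'.1 hp'.1 (ms.trans_le (min_le_right _ _)) (w p') q' Y
    ((hMw p' hp').trans (le_max_left _ _))
    (hq'.trans (le_max_of_le_right (le_max_of_le_left (by nlinarith)))) hY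
    fun i j => (hYk i j).trans (le_max_of_le_right (le_max_right _ _)))).2
  have f4 : |u p - w p'| ≤ σ := abs_le.2 ⟨m3, m4.le⟩
  have f5 : matNorm d (Y - Y) = 0 := by rw [sub_self, matNorm, matCLM_zero, norm_zero]
  rw [f5, add_zero] at f2
  have f6 : L₀ * (|u p - w p'| + ‖q - q'‖) ≤ θ / 4 := by
    have : L₀ * (|u p - w p'| + ‖q - q'‖) ≤ L₀ * (σ + σ) :=
      mul_le_mul_of_nonneg_left (by linarith) hL₀
    linarith
  linarith

end Comparison

section Barriers

variable {d : ℕ} {t₀ T₁ r C₀ L₀ c₀ : ℝ}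
  {g : ℝ → ℝ → EuclideanSpace ℝ (Fin d) → Matrix (Fin d) (Fin d) ℝ → ℝ}

lemma IsTest.const_mul {U : Set (Spacetime d)} {φ φt : Spacetime d → ℝ}
    {Dφ : Spacetime d → EuclideanSpace ℝ (Fin d)} {D2φ : Spacetime d → Matrix (Fin d) (Fin d) ℝ}
    (h : IsTest U φ φt Dφ D2φ) (c : ℝ) :
    IsTest U (fun p => c * φ p) (fun p => c * φt p) (fun p => c • Dφ p) fun p => c • D2φ p := by
  refine ⟨h.isOpen, continuousOn_const.mul h.cont, continuousOn_const.mul h.cont_time,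
    h.cont_grad.const_smul c, h.cont_hess.const_smul c, fun q hq => ?_⟩
  obtain ⟨a1, a2, a3, a4⟩ := h.deriv q hq
  refine ⟨a1.const_mul c, ?_, ?_, a4.smul c⟩
  · rw [hasGradientAt_iff_hasFDerivAt] at a2 ⊢
    rw [map_smul]
    exact a2.const_mul c
  · rw [matCLM_smul]
    exact a3.const_smul c

lemma IsTest.const_add_mul_sq_dist (c k : ℝ) (p₀ : Spacetime d) :
    IsTest univ (fun p => c + k * ((p.1 - p₀.1) ^ 2 + ‖p.2 - p₀.2‖ ^ 2))
      (fun p => 2 * k * (p.1 - p₀.1)) (fun p => (2 * k) • (p.2 - p₀.2)) fun _ => (2 * k) • 1 := by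
  have t := IsTest.quadratic c 0 k 0 (X := (2 * k) • (1 : Matrix (Fin d) (Fin d) ℝ))
    (Matrix.isSymm_one.smul _) p₀
  simp only [matCLM_smul, matCLM_one, smul_apply, one_apply_eq_self, inner_smul_left,
    real_inner_self_eq_norm_sq, inner_zero_left, conj_trivial, zero_mul, add_zero, zero_add] at t
  refine (funext fun p => ?_ : (fun p : Spacetime d =>
    c + k * ((p.1 - p₀.1) ^ 2 + ‖p.2 - p₀.2‖ ^ 2)) = _) ▸ t
  ring

/-- A function that is strictly monotone for the extremal operator gives, after subtracting a large
multiple of it, a classical subsolution below the data that nearly touches them at `b`. -/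
lemma exists_lower_barrier_of (hT : t₀ ≤ T₁) (hg : IsElliptic d t₀ T₁ C₀ L₀ c₀ g) (hL₀ : 0 ≤ L₀)
    (hc₀ : 0 ≤ c₀) {h : Spacetime d → ℝ} (hh : ContinuousOn h (cylBdry d t₀ T₁ r))
    (hhb : ∃ M, ∀ p ∈ cylBdry d t₀ T₁ r, |h p| ≤ M) {b : Spacetime d}
    (hb : b ∈ cylBdry d t₀ T₁ r) {η : ℝ} (hη : 0 < η) {G Gt : Spacetime d → ℝ}
    {DG : Spacetime d → EuclideanSpace ℝ (Fin d)} {D2G : Spacetime d → Matrix (Fin d) (Fin d) ℝ}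
    (hG : IsTest univ G Gt DG D2G) (hGb : G b = 0) (hG0 : ∀ p ∈ cylQbar d t₀ T₁ r, 0 ≤ G p)
    (hG2 : ∀ p ∈ cylQ d t₀ T₁ r, (-D2G p).PosSemidef) {κ : ℝ} (hκ : 0 < κ)
    (hGκ : ∀ p ∈ cylQ d t₀ T₁ r,
      Gt p + L₀ * (G p + ‖DG p‖) - c₀ * (-D2G p).trace ≤ -κ) :
    ∃ l : Spacetime d → ℝ, Continuous l ∧ ViscSubsolProp d g (cylQ d t₀ T₁ r) l ∧
      (∀ p ∈ cylBdry d t₀ T₁ r, l p ≤ h p) ∧ h b - η ≤ l b := by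
  obtain ⟨M, hM⟩ := hhb
  have hM0 : 0 ≤ M := (abs_nonneg _).trans (hM b hb)
  obtain ⟨ρ, hρ, H⟩ := Metric.continuousOn_iff.1 hh b hb η hη
  set k := 2 * M / ρ ^ 2 with hk
  have hk0 : 0 ≤ k := by positivity
  have hX : ((2 * -k) • (1 : Matrix (Fin d) (Fin d) ℝ)).IsSymm := Matrix.isSymm_one.smul _
  set P : Spacetime d → ℝ := fun p => k * ((p.1 - b.1) ^ 2 + ‖p.2 - b.2‖ ^ 2) with hP
  have hP0 : ∀ p, 0 ≤ P p := fun p => by positivity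
  obtain ⟨B, hB⟩ := isCompact_cylQbar.exists_bound_of_continuousOn (s := cylQbar d t₀ T₁ r)
    (f := fun p : Spacetime d => 2 * k * (p.1 - b.1) + C₀
      + L₀ * (|h b - η| + P p + 2 * k * ‖p.2 - b.2‖ + 2 * k)) (by fun_prop)
  set K := max 0 (B / κ) with hK
  have hK0 : 0 ≤ K := le_max_left _ _
  have hKB : B ≤ K * κ := (div_le_iff₀ hκ).1 (le_max_right _ _)
  have t := (IsTest.const_add_mul_sq_dist (h b - η) (-k) b).add (hG.const_mul (-K))
  rw [inter_univ] at t
  simp only [neg_mul k, ← sub_eq_add_neg (h b - η)] at t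
  refine ⟨_, continuousOn_univ.1 t.cont, t.viscSubsolProp hg hc₀ fun p hp => ?_, fun p hp => ?_, ?_⟩
  · have hpb := cylQ_subset_cylQbar hp
    have hs := cylQ_fst_mem hp
    have hGp := hG0 p hpb
    simp only [Pi.add_apply]
    have e1 := hg.ell p.1 hs (h b - η - P p + -K * G p)
      ((2 * -k) • (p.2 - b.2) + -K • DG p) ((2 * -k) • 1 + -K • D2G p) ((2 * -k) • 1)
      (hX.add ((hG.deriv p trivial).2.2.2.smul _)) hX (by
        rw [add_sub_cancel_left, neg_smul, ← smul_neg]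
        exact (hG2 p hp).smul hK0)
    rw [add_sub_cancel_left, neg_smul, ← smul_neg, Matrix.trace_smul, smul_eq_mul] at e1
    have e2 := (abs_le.1 (hg.lip p.1 hs (h b - η - P p + -K * G p) 0
      ((2 * -k) • (p.2 - b.2) + -K • DG p) 0 ((2 * -k) • 1) 0 hX Matrix.isSymm_zero)).1
    have e3 := (abs_le.1 (hg.zero p.1 hs)).1
    have e4 : |h b - η - P p + -K * G p - 0| ≤ |h b - η| + P p + K * G p := by
      rw [sub_zero]
      refine (abs_add_le _ _).trans (add_le_add ((abs_sub _ _).trans ?_) ?_)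
      · rw [abs_of_nonneg (hP0 p)]
      · rw [abs_mul, abs_neg, abs_of_nonneg hK0, abs_of_nonneg hGp]
    have e5 : ‖(2 * -k) • (p.2 - b.2) + -K • DG p - 0‖ ≤ 2 * k * ‖p.2 - b.2‖ + K * ‖DG p‖ := by
      rw [sub_zero]
      refine (norm_add_le _ _).trans (add_le_add ?_ ?_)
      · rw [norm_smul, Real.norm_eq_abs, mul_neg, abs_neg, abs_of_nonneg (by positivity)]
      · rw [norm_smul, Real.norm_eq_abs, abs_neg, abs_of_nonneg hK0]
    have e6 : matNorm d ((2 * -k) • 1 - 0) ≤ 2 * k := by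
      rw [sub_zero]
      refine (matNorm_smul_one_le _).trans ?_
      rw [mul_neg, abs_neg, abs_of_nonneg (by positivity)]
    have e7 := mul_le_mul_of_nonneg_left (add_le_add (add_le_add e4 e5) e6) hL₀
    have e8 := (le_abs_self _).trans (hB p hpb)
    have e9 := mul_le_mul_of_nonneg_left (hGκ p hp) hK0
    rw [smul_neg, ← neg_smul] at e1
    linarith
  · have hGp := mul_nonneg hK0 (hG0 p (cylBdry_subset_cylQbar hT hp))
    have h1 := hP0 p
    simp only [Pi.add_apply]
    by_cases hpρ : dist p b < ρ
    · have := (abs_lt.1 (H p hp hpρ)).1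
      linarith
    · have h2 : k * ρ ^ 2 ≤ P p := by
        push Not at hpρ
        rw [Prod.dist_eq, dist_eq_norm, dist_eq_norm, le_max_iff] at hpρ
        simp only [hP]
        refine mul_le_mul_of_nonneg_left ?_ hk0
        rcases hpρ with h3 | h3
        · have := pow_le_pow_left₀ hρ.le h3 2
          rw [Real.norm_eq_abs, sq_abs] at this
          nlinarith [sq_nonneg ‖p.2 - b.2‖]
        · have := pow_le_pow_left₀ hρ.le h3 2
          nlinarith [sq_nonneg (p.1 - b.1)]
      rw [hk, div_mul_cancel₀ _ (by positivity)] at h2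
      have h4 := (abs_le.1 (hM p hp)).1
      have h5 := (abs_le.1 (hM b hb)).2
      linarith
  · simp [hGb]

lemma matCLM_vecMulVec (n v : EuclideanSpace ℝ (Fin d)) :
    matCLM d (Matrix.vecMulVec n n) v = ⟪n, v⟫ • n := by
  ext i
  rw [matCLM, Matrix.ofLp_toEuclideanCLM, Matrix.vecMulVec_mulVec]
  simp [PiLp.inner_apply, dotProduct, mul_comm]

lemma hasDerivAt_exp_time (s : ℝ) : HasDerivAt (fun s => Real.exp ((L₀ + 1) * (T₁ - s)))
    (-(L₀ + 1) * Real.exp ((L₀ + 1) * (T₁ - s))) s :=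
  ((((hasDerivAt_id s).const_sub T₁).const_mul (L₀ + 1)).exp).congr_deriv (by simp; ring)

/-- Lower barriers at every point of the parabolic boundary. -/
lemma exists_lower_barrier (hT : t₀ ≤ T₁) (hr : 0 < r) (hg : IsElliptic d t₀ T₁ C₀ L₀ c₀ g)
    (hL₀ : 0 ≤ L₀) (hc₀ : 0 < c₀) {h : Spacetime d → ℝ} (hh : ContinuousOn h (cylBdry d t₀ T₁ r))
    (hhb : ∃ M, ∀ p ∈ cylBdry d t₀ T₁ r, |h p| ≤ M) {b : Spacetime d}
    (hb : b ∈ cylBdry d t₀ T₁ r) {η : ℝ} (hη : 0 < η) :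
    ∃ l : Spacetime d → ℝ, Continuous l ∧ ViscSubsolProp d g (cylQ d t₀ T₁ r) l ∧
      (∀ p ∈ cylBdry d t₀ T₁ r, l p ≤ h p) ∧ h b - η ≤ l b := by
  have hE1 : ∀ p ∈ cylQbar d t₀ T₁ r, 1 ≤ Real.exp ((L₀ + 1) * (T₁ - p.1)) := fun p hp =>
    Real.one_le_exp (mul_nonneg (by linarith) (by linarith [hp.1.2]))
  rcases hb with hb' | hb'
  · obtain ⟨n, hn⟩ : ∃ n, n = r⁻¹ • b.2 := ⟨_, rfl⟩
    have hbr : ‖b.2‖ = r := mem_sphere_zero_iff_norm.1 hb'.2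
    have hn1 : ‖n‖ = 1 := by
      rw [hn, norm_smul, hbr, norm_inv, Real.norm_of_nonneg hr.le, inv_mul_cancel₀ hr.ne']
    set β := (L₀ + 1) / c₀ with hβ
    have hβ0 : 0 < β := by positivity
    have hβc : c₀ * β = L₀ + 1 := by rw [hβ]; field_simp
    set e : EuclideanSpace ℝ (Fin d) → ℝ := fun x => Real.exp (-β * (r - ⟪n, x⟫)) with he
    have he0 : ∀ x, 0 < e x := fun x => Real.exp_pos _
    have he1 : ∀ p ∈ cylQbar d t₀ T₁ r, e p.2 ≤ 1 := fun p hp => by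
      have h1 := real_inner_le_norm n p.2
      have h2 : ‖p.2‖ ≤ r := mem_closedBall_zero_iff.1 hp.2
      rw [hn1, one_mul] at h1
      exact Real.exp_le_one_iff.2 (by nlinarith)
    have hed : ∀ x, HasFDerivAt e (e x • (β • innerSL ℝ n)) x := fun x => by
      have h1 : HasFDerivAt (fun x : EuclideanSpace ℝ (Fin d) => ⟪n, x⟫) (innerSL ℝ n) x :=
        (innerSL ℝ n).hasFDerivAt
      have h2 := ((h1.const_sub r).const_mul (-β)).exp
      refine h2.congr_fderiv ?_
      rw [smul_neg, neg_smul, neg_neg]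
    have t := IsTest.mul_of_time_space (d := d) (f := fun s => Real.exp ((L₀ + 1) * (T₁ - s)))
      (f' := fun s => -(L₀ + 1) * Real.exp ((L₀ + 1) * (T₁ - s)))
      (G := fun x => 1 - e x) (DG := fun x => (-β * e x) • n)
      (D2G := fun x => (-β ^ 2 * e x) • Matrix.vecMulVec n n) hasDerivAt_exp_time (by fun_prop)
      (fun x => by
        rw [hasGradientAt_iff_hasFDerivAt]
        refine ((hed x).const_sub 1).congr_fderiv ?_
        ext v
        simp
        ring)
      (fun x => by
        refine (((hed x).const_mul (-β)).smul_const n).congr_fderiv ?_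
        ext1 v
        rw [matCLM_smul, smul_apply, matCLM_vecMulVec]
        simp [smul_smul]
        ring_nf) (by
        have : Continuous e := continuous_iff_continuousAt.2 fun x => (hed x).continuousAt
        fun_prop)
      fun x => by
        refine Matrix.IsSymm.smul ?_ _
        exact Matrix.transpose_vecMulVec _ _
    have htr : Matrix.trace (Matrix.vecMulVec n n) = 1 := by
      rw [Matrix.trace_vecMulVec]
      have := real_inner_self_eq_norm_sq n
      rw [hn1, PiLp.inner_apply] at this
      simpa [dotProduct, ← sq] using this
    refine exists_lower_barrier_of hT hg hL₀ hc₀.le hh hhb (Or.inl hb') hη t ?_ (fun p hp => ?_)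
      (fun p hp => ?_) (κ := min 1 β) (by positivity) fun p hp => ?_
    · have : e b.2 = 1 := by
        simp only [he, hn]
        rw [inner_smul_left, real_inner_self_eq_norm_sq, hbr, conj_trivial]
        rw [show r - r⁻¹ * r ^ 2 = 0 by field_simp; ring, mul_zero, Real.exp_zero]
      simp [this]
    · exact mul_nonneg (Real.exp_pos _).le (by linarith [he1 p hp])
    · have : (Matrix.vecMulVec n n : Matrix (Fin d) (Fin d) ℝ).PosSemidef := by
        simpa using Matrix.posSemidef_vecMulVec_self_star (n.ofLp : Fin d → ℝ)
      rw [smul_smul, ← neg_smul]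
      have h1 := (he0 p.2).le
      refine this.smul ?_
      have := Real.exp_pos ((L₀ + 1) * (T₁ - p.1))
      have : 0 ≤ Real.exp ((L₀ + 1) * (T₁ - p.1)) * (β ^ 2 * e p.2) := by positivity
      linarith
    · have h1 := hE1 p (cylQ_subset_cylQbar hp)
      have h2 := he1 p (cylQ_subset_cylQbar hp)
      have h3 := he0 p.2
      have h5 : |-β * e p.2| = β * e p.2 := by
        rw [neg_mul, abs_neg, abs_of_pos (by positivity)]
      rw [smul_smul, smul_smul, norm_smul, hn1, ← neg_smul, Matrix.trace_smul, htr, mul_one,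
        smul_eq_mul, mul_one, Real.norm_eq_abs, abs_mul, abs_of_pos (by linarith), h5]
      have h4 : min 1 β ≤ 1 - e p.2 + β * e p.2 := by
        rcases le_total 1 β with h5 | h5
        · rw [min_eq_left h5]; nlinarith
        · rw [min_eq_right h5]; nlinarith
      generalize Real.exp ((L₀ + 1) * (T₁ - p.1)) = E at *
      have h6 : min 1 β ≤ E * (1 - e p.2 + β * e p.2) := by
        have : 0 ≤ 1 - e p.2 + β * e p.2 := (lt_min one_pos hβ0).le.trans h4
        nlinarith
      have h7 : c₀ * -(E * (-β ^ 2 * e p.2)) = E * (L₀ + 1) * β * e p.2 := by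
        rw [← hβc]; ring
      simp only [neg_mul] at h7 ⊢
      linarith
  · have t := IsTest.mul_of_time_space (d := d)
      (f := fun s => Real.exp ((L₀ + 1) * (T₁ - s)) - 1)
      (f' := fun s => -(L₀ + 1) * Real.exp ((L₀ + 1) * (T₁ - s)))
      (G := fun _ => 1) (DG := fun _ => 0) (D2G := fun _ => 0)
      (fun s => (hasDerivAt_exp_time s).sub_const 1) (by fun_prop)
      (fun x => by rw [hasGradientAt_iff_hasFDerivAt, map_zero]; exact hasFDerivAt_const _ _)
      (fun x => by rw [matCLM_zero]; exact hasFDerivAt_const _ _) continuous_const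
      fun _ => Matrix.isSymm_zero
    refine exists_lower_barrier_of hT hg hL₀ hc₀.le hh hhb (Or.inr hb') hη t ?_ (fun p hp => ?_)
      (fun p hp => ?_) one_pos fun p hp => ?_
    · simp [show b.1 = T₁ from hb'.1]
    · linarith [hE1 p hp]
    · simpa using Matrix.PosSemidef.zero
    · have := hE1 p (cylQ_subset_cylQbar hp)
      simp only [smul_zero, norm_zero, neg_zero, Matrix.trace_zero, mul_zero]
      linarith

end Barriers

section Perturbation

variable {d : ℕ} {t₀ T₁ r C₀ L₀ c₀ : ℝ}
  {g : ℝ → ℝ → EuclideanSpace ℝ (Fin d) → Matrix (Fin d) (Fin d) ℝ → ℝ}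
  {U : Set (Spacetime d)} {φ φt : Spacetime d → ℝ} {Dφ : Spacetime d → EuclideanSpace ℝ (Fin d)}
  {D2φ : Spacetime d → Matrix (Fin d) (Fin d) ℝ}

lemma sq_dist_le (p q : Spacetime d) :
    dist p q ^ 2 ≤ (p.1 - q.1) ^ 2 + ‖p.2 - q.2‖ ^ 2 := by
  rw [Prod.dist_eq, dist_eq_norm, dist_eq_norm, Real.norm_eq_abs]
  rcases max_choice |p.1 - q.1| ‖p.2 - q.2‖ with h | h <;> rw [h]
  · rw [sq_abs]
    linarith [sq_nonneg ‖p.2 - q.2‖]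
  · linarith [sq_nonneg (p.1 - q.1)]

lemma exists_closedBall_inter_subset_cylQ (hT : t₀ ≤ T₁) {p : Spacetime d}
    (hp : p ∈ cylQ d t₀ T₁ r) (hU : IsOpen U) (hpU : p ∈ U) :
    ∃ ρ > 0, Metric.closedBall p ρ ⊆ U ∧
      Metric.closedBall p ρ ∩ cylQbar d t₀ T₁ r ⊆ cylQ d t₀ T₁ r := by
  obtain ⟨ρ, hρ, H⟩ := Metric.nhds_basis_closedBall.mem_iff.1
    ((hU.inter (isClosed_cylBdry (d := d) (r := r) hT).isOpen_compl).mem_nhds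
      ⟨hpU, notMem_cylBdry hp⟩)
  exact ⟨ρ, hρ, fun q hq => (H hq).1, fun q hq => mem_cylQ_of_notMem_cylBdry hq.2 (H hq.1).2⟩

/-- A strict classical inequality at a point survives nearby when a small paraboloid is added. -/
lemma IsTest.exists_strict_perturbation (hT : t₀ ≤ T₁) (hg : IsElliptic d t₀ T₁ C₀ L₀ c₀ g)
    (hL₀ : 0 ≤ L₀) (hφ : IsTest U φ φt Dφ D2φ) {p : Spacetime d} (hp : p ∈ cylQ d t₀ T₁ r)
    (hpU : p ∈ U) (hlt : 0 < -φt p - g p.1 (φ p) (Dφ p) (D2φ p)) :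
    ∃ κ > 0, ∃ ρ > 0, ∃ ψt Dψ D2ψ,
      (∀ m : ℝ, IsTest U (fun q => φ q + (m + κ * ((q.1 - p.1) ^ 2 + ‖q.2 - p.2‖ ^ 2)))
        ψt Dψ D2ψ) ∧ Metric.closedBall p ρ ⊆ U ∧
      Metric.closedBall p ρ ∩ cylQbar d t₀ T₁ r ⊆ cylQ d t₀ T₁ r ∧
      ∀ q ∈ Metric.closedBall p ρ ∩ cylQ d t₀ T₁ r, ∀ m : ℝ, |m| < ρ →
        0 < -ψt q - g q.1 (φ q + (m + κ * ((q.1 - p.1) ^ 2 + ‖q.2 - p.2‖ ^ 2))) (Dψ q)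
          (D2ψ q) := by
  set ε := -φt p - g p.1 (φ p) (Dφ p) (D2φ p) with hε
  set κ := ε / (2 * (L₀ + 1)) with hκ
  have hκ0 : 0 < κ := by positivity
  have hLκ : L₀ * (2 * κ) < ε := by
    have : (L₀ + 1) * (2 * κ) = ε := by rw [hκ]; field_simp
    linarith
  have t : ∀ m : ℝ, IsTest U (fun q => φ q + (m + κ * ((q.1 - p.1) ^ 2 + ‖q.2 - p.2‖ ^ 2)))
      (fun q => φt q + 2 * κ * (q.1 - p.1)) (fun q => Dφ q + (2 * κ) • (q.2 - p.2))
      (fun q => D2φ q + (2 * κ) • 1) := fun m => by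
    have := hφ.add (IsTest.const_add_mul_sq_dist m κ p)
    rwa [inter_univ] at this
  set F : Spacetime d × ℝ → ℝ := fun a => -(φt a.1 + 2 * κ * (a.1.1 - p.1))
    - g a.1.1 (φ a.1 + (a.2 + κ * ((a.1.1 - p.1) ^ 2 + ‖a.1.2 - p.2‖ ^ 2)))
      (Dφ a.1 + (2 * κ) • (a.1.2 - p.2)) (D2φ a.1 + (2 * κ) • 1) with hF
  have cF : ContinuousOn F ((U ∩ cylQ d t₀ T₁ r) ×ˢ univ) := by
    have t0 := t 0
    have hfst : ContinuousOn Prod.fst ((U ∩ cylQ d t₀ T₁ r) ×ˢ (univ : Set ℝ)) :=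
      continuous_fst.continuousOn
    have hm : MapsTo Prod.fst ((U ∩ cylQ d t₀ T₁ r) ×ˢ (univ : Set ℝ)) U := fun a ha => ha.1.1
    refine (t0.cont_time.comp hfst hm).neg.sub (hg.cont.comp (f := fun a : Spacetime d × ℝ =>
      (a.1.1, φ a.1 + (a.2 + κ * ((a.1.1 - p.1) ^ 2 + ‖a.1.2 - p.2‖ ^ 2)),
        Dφ a.1 + (2 * κ) • (a.1.2 - p.2), D2φ a.1 + (2 * κ) • 1)) ?_ ?_)
    · refine ContinuousOn.prodMk (by fun_prop) (ContinuousOn.prodMk ?_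
        ((t0.cont_grad.comp hfst hm).prodMk (t0.cont_hess.comp hfst hm)))
      exact (hφ.cont.comp hfst hm).add (Continuous.continuousOn (by fun_prop))
    · exact fun a ha => ⟨cylQ_fst_mem ha.1.2, trivial, trivial, (t0.deriv a.1 ha.1.1).2.2.2⟩
  have hFp : 0 < F (p, 0) := by
    have h1 := (abs_le.1 (hg.lip p.1 (cylQ_fst_mem hp) (φ p) (φ p) (Dφ p) (Dφ p)
      (D2φ p + (2 * κ) • 1) (D2φ p) ((t 0).deriv p hpU).2.2.2 (hφ.deriv p hpU).2.2.2)).2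
    rw [sub_self, sub_self, abs_zero, norm_zero, add_sub_cancel_left, zero_add, zero_add] at h1
    have h2 := (matNorm_smul_one_le (d := d) (2 * κ)).trans (abs_of_pos (by positivity)).le
    have h3 := mul_le_mul_of_nonneg_left h2 hL₀
    simp only [hF, sub_self, norm_zero, smul_zero, mul_zero, add_zero, ne_eq, OfNat.ofNat_ne_zero,
      not_false_eq_true, zero_pow]
    linarith
  obtain ⟨ρ₁, hρ₁, H₁⟩ := Metric.continuousOn_iff.1 cF (p, 0) ⟨⟨hpU, hp⟩, trivial⟩ _ hFp
  obtain ⟨ρ₂, hρ₂, H₂, H₃⟩ := exists_closedBall_inter_subset_cylQ hT hp hφ.isOpen hpU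
  have hle1 : min (ρ₁ / 2) ρ₂ < ρ₁ := (min_le_left _ _).trans_lt (half_lt_self hρ₁)
  have hsub := Metric.closedBall_subset_closedBall (x := p) (min_le_right (ρ₁ / 2) ρ₂)
  refine ⟨κ, hκ0, min (ρ₁ / 2) ρ₂, by positivity, _, _, _, t, hsub.trans H₂,
    (inter_subset_inter_left _ hsub).trans H₃, fun q hq m hm => ?_⟩
  have h1 := H₁ (q, m) ⟨⟨H₂ (hsub hq.1), hq.2⟩, trivial⟩ (by
    rw [Prod.dist_eq]
    refine max_lt ((Metric.mem_closedBall.1 hq.1).trans_lt hle1) ?_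
    rw [Real.dist_eq, sub_zero]
    exact hm.trans hle1)
  rw [Real.dist_eq] at h1
  have := (abs_lt.1 h1).1
  exact (by linarith : 0 < F (q, m))

end Perturbation

section Envelope

variable {α : Type*} [PseudoMetricSpace α] {S : Set α} {f : α → ℝ} {z : α} {c M : ℝ}

/-- The upper semicontinuous envelope of a function on a set. -/
noncomputable def uscEnvelope (S : Set α) (f : α → ℝ) (z : α) : ℝ :=
  sInf {c | ∃ ρ > 0, ∀ z' ∈ S, dist z' z < ρ → f z' ≤ c}

lemma le_of_mem_uscEnvelope_set (hz : z ∈ S)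
    (h : c ∈ {c | ∃ ρ > 0, ∀ z' ∈ S, dist z' z < ρ → f z' ≤ c}) : f z ≤ c := by
  obtain ⟨ρ, hρ, H⟩ := h
  exact H z hz (by rwa [dist_self])

lemma le_uscEnvelope (hM : ∀ z ∈ S, f z ≤ M) (hz : z ∈ S) : f z ≤ uscEnvelope S f z :=
  le_csInf ⟨M, 1, one_pos, fun z' hz' _ => hM z' hz'⟩ fun _ => le_of_mem_uscEnvelope_set hz

lemma uscEnvelope_le {ρ : ℝ} (hρ : 0 < ρ) (hz : z ∈ S)
    (H : ∀ z' ∈ S, dist z' z < ρ → f z' ≤ c) : uscEnvelope S f z ≤ c :=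
  csInf_le ⟨f z, fun _ => le_of_mem_uscEnvelope_set hz⟩ ⟨ρ, hρ, H⟩

lemma exists_of_uscEnvelope_lt (hM : ∀ z ∈ S, f z ≤ M) (h : uscEnvelope S f z < c) :
    ∃ ρ > 0, ∀ z' ∈ S, dist z' z < ρ → f z' < c := by
  rw [uscEnvelope] at h
  obtain ⟨c', ⟨ρ, hρ, H⟩, hc'⟩ := exists_lt_of_csInf_lt
    (by exact ⟨M, 1, one_pos, fun z' hz' _ => hM z' hz'⟩) h
  exact ⟨ρ, hρ, fun z' hz' hd => (H z' hz' hd).trans_lt hc'⟩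

lemma exists_lt_of_lt_uscEnvelope (hz : z ∈ S) (h : c < uscEnvelope S f z) {ρ : ℝ} (hρ : 0 < ρ) :
    ∃ z' ∈ S, dist z' z < ρ ∧ c < f z' := by
  by_contra! hcon
  exact h.not_ge (uscEnvelope_le hρ hz hcon)

lemma upperSemicontinuousOn_uscEnvelope (hM : ∀ z ∈ S, f z ≤ M) :
    UpperSemicontinuousOn (uscEnvelope S f) S := by
  intro z hz c hc
  obtain ⟨c', hc1, hc2⟩ := exists_between hc
  obtain ⟨ρ, hρ, H⟩ := exists_of_uscEnvelope_lt hM hc1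
  filter_upwards [self_mem_nhdsWithin, mem_nhdsWithin_of_mem_nhds (Metric.ball_mem_nhds z hρ)]
    with z' hz' hd
  refine (uscEnvelope_le (ρ := ρ - dist z' z) (sub_pos.2 hd) hz' fun y hy hyd => ?_).trans_lt hc2
  exact (H y hy (by linarith [dist_triangle y z' z])).le

lemma uscEnvelope_le_of_le {k : α → ℝ} (hk : UpperSemicontinuousOn k S)
    (h : ∀ z ∈ S, f z ≤ k z) (hz : z ∈ S) : uscEnvelope S f z ≤ k z := by
  refine le_of_forall_gt fun c hc => ?_
  obtain ⟨c', hc1, hc2⟩ := exists_between hc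
  obtain ⟨ρ, hρ, H⟩ := Metric.mem_nhdsWithin_iff.1 (hk z hz c' hc1)
  exact (uscEnvelope_le hρ hz fun z' hz' hd =>
    (h z' hz').trans (show k z' < c' from H ⟨hd, hz'⟩).le).trans_lt hc2

end Envelope

section Perron

variable {d : ℕ} {t₀ T₁ r C₀ L₀ c₀ : ℝ}
  {g : ℝ → ℝ → EuclideanSpace ℝ (Fin d) → Matrix (Fin d) (Fin d) ℝ → ℝ}

/-- The upper envelope of a supremum of subsolutions is a subsolution. -/
lemma viscSubsolProp_uscEnvelope (hT : t₀ ≤ T₁) (hg : IsElliptic d t₀ T₁ C₀ L₀ c₀ g)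
    (hL₀ : 0 ≤ L₀) {F : Set (Spacetime d → ℝ)}
    (hF : ∀ w ∈ F, UpperSemicontinuousOn w (cylQbar d t₀ T₁ r) ∧
      ViscSubsolProp d g (cylQ d t₀ T₁ r) w) {W : Spacetime d → ℝ} {M : ℝ}
    (hWM : ∀ z ∈ cylQbar d t₀ T₁ r, W z ≤ M)
    (hFW : ∀ w ∈ F, ∀ z ∈ cylQbar d t₀ T₁ r, w z ≤ W z)
    (hWF : ∀ z ∈ cylQbar d t₀ T₁ r, ∀ c < W z, ∃ w ∈ F, c < w z) :
    ViscSubsolProp d g (cylQ d t₀ T₁ r) (uscEnvelope (cylQbar d t₀ T₁ r) W) := by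
  refine viscSubsolProp_of fun p hp φ φt Dφ D2φ U hφ hpU heq hle => ?_
  by_contra! hlt
  rw [heq] at hlt
  have hpb := cylQ_subset_cylQbar hp
  obtain ⟨κ, hκ, ρ, hρ, ψt, Dψ, D2ψ, t, hU, hQ, H⟩ :=
    hφ.exists_strict_perturbation hT hg hL₀ hp hpU hlt
  set N : Spacetime d → ℝ := fun q => κ * ((q.1 - p.1) ^ 2 + ‖q.2 - p.2‖ ^ 2) with hN
  set K := Metric.closedBall p ρ ∩ cylQbar d t₀ T₁ r with hK
  have hKc : IsCompact K := isCompact_cylQbar.inter_left Metric.isClosed_closedBall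
  set ε := min (ρ / 2) (κ * ρ ^ 2 / 2) with hε
  have hε0 : 0 < ε := by positivity
  have hερ : ε < ρ := (min_le_left _ _).trans_lt (half_lt_self hρ)
  have hεκ : ε < κ * ρ ^ 2 := (min_le_right _ _).trans_lt (half_lt_self (by positivity))
  have hcont : ContinuousOn (fun q => φ q + N q) U :=
    hφ.cont.add (Continuous.continuousOn (by fun_prop))
  -- a member of the family that almost touches
  obtain ⟨ρ₁, hρ₁, H₁⟩ := Metric.continuousOn_iff.1 hcont p hpU (ε / 2) (by positivity)
  obtain ⟨z, hz, hzp, hzW⟩ := exists_lt_of_lt_uscEnvelope hpb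
    (show φ p - ε / 2 < uscEnvelope (cylQbar d t₀ T₁ r) W p by rw [heq]; linarith)
    (lt_min hρ hρ₁)
  obtain ⟨w, hwF, hwz⟩ := hWF z hz _ hzW
  have hzK : z ∈ K := ⟨(hzp.trans_le (min_le_left _ _)).le, hz⟩
  have hzN : φ z + N z < φ p + ε / 2 := by
    have := H₁ z (hU hzK.1) (hzp.trans_le (min_le_right _ _))
    rw [Real.dist_eq] at this
    have h1 := (abs_lt.1 this).2
    simp only [hN, sub_self, norm_zero, ne_eq, OfNat.ofNat_ne_zero, not_false_eq_true, zero_pow,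
      add_zero, mul_zero] at h1 ⊢
    linarith
  have husc : UpperSemicontinuousOn (fun q => w q + -(φ q + N q)) K :=
    ((hF w hwF).1.mono inter_subset_right).add
      (hcont.mono fun q hq => hU hq.1).neg.upperSemicontinuousOn
  obtain ⟨q, hq, hmax⟩ := husc.exists_isMaxOn ⟨z, hzK⟩ hKc
  have hm1 := isMaxOn_iff.1 hmax z hzK
  have hwφ : ∀ y ∈ K, w y ≤ φ y := fun y hy =>
    (hFW w hwF y hy.2).trans ((le_uscEnvelope hWM hy.2).trans (hle y ⟨hU hy.1, hQ hy⟩))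
  have hNq : N q < κ * ρ ^ 2 := by
    have := hwφ q hq
    linarith
  have hqb : q ∈ Metric.ball p ρ := by
    have h1 := mul_le_mul_of_nonneg_left (sq_dist_le q p) hκ.le
    exact lt_of_pow_lt_pow_left₀ 2 hρ.le (lt_of_mul_lt_mul_left (h1.trans_lt hNq) hκ.le)
  have hN0 : 0 ≤ N q := by positivity
  set m := w q - (φ q + N q) with hm
  have hmρ : |m| < ρ := by
    have := hwφ q hq
    rw [abs_lt]
    constructor <;> linarith
  have key := (hF w hwF).2.le ((t m).mono (Metric.isOpen_ball (x := p) (ε := ρ))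
    (Metric.ball_subset_closedBall.trans hU)) (hQ hq) hqb (by simp only [hm, hN]; ring)
    fun y hy => by
      have h1 := isMaxOn_iff.1 hmax y ⟨Metric.ball_subset_closedBall hy.1,
        cylQ_subset_cylQbar hy.2⟩
      simp only [hN] at h1 hm
      linarith
  have h2 := H q ⟨hq.1, hQ hq⟩ m hmρ
  have h3 : φ q + (m + κ * ((q.1 - p.1) ^ 2 + ‖q.2 - p.2‖ ^ 2)) = w q := by
    simp only [hm, hN]; ring
  rw [h3] at h2
  linarith

/-- The lower envelope of a maximal subsolution is a supersolution. -/
lemma viscSupersolProp_neg_uscEnvelope_neg (hT : t₀ ≤ T₁) (hg : IsElliptic d t₀ T₁ C₀ L₀ c₀ g)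
    (hL₀ : 0 ≤ L₀) (hc₀ : 0 ≤ c₀) {W : Spacetime d → ℝ}
    (hW : UpperSemicontinuousOn W (cylQbar d t₀ T₁ r)) {M : ℝ}
    (hWM : ∀ z ∈ cylQbar d t₀ T₁ r, |W z| ≤ M) (hWs : ViscSubsolProp d g (cylQ d t₀ T₁ r) W)
    (hmax : ∀ w : Spacetime d → ℝ, UpperSemicontinuousOn w (cylQbar d t₀ T₁ r) →
      (∃ M, ∀ p ∈ cylQbar d t₀ T₁ r, |w p| ≤ M) → ViscSubsolProp d g (cylQ d t₀ T₁ r) w →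
      (∀ p ∈ cylBdry d t₀ T₁ r, w p ≤ W p) → ∀ p ∈ cylQbar d t₀ T₁ r, w p ≤ W p) :
    ViscSupersolProp d g (cylQ d t₀ T₁ r) (-uscEnvelope (cylQbar d t₀ T₁ r) (-W)) := by
  refine ViscSubsolProp.neg (viscSubsolProp_of fun p hp φ φt Dφ D2φ U hφ hpU heq hle => ?_)
  by_contra! hlt
  rw [heq] at hlt
  have hpb := cylQ_subset_cylQbar hp
  have hWM' : ∀ z ∈ cylQbar d t₀ T₁ r, (-W) z ≤ M := fun z hz => by
    linarith [(abs_le.1 (hWM z hz)).1, Pi.neg_apply W z]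
  obtain ⟨κ, hκ, ρ, hρ, ψt, Dψ, D2ψ, t, hU, hQ, H⟩ :=
    hφ.exists_strict_perturbation hT hg.dual hL₀ hp hpU hlt
  set N : Spacetime d → ℝ := fun q => κ * ((q.1 - p.1) ^ 2 + ‖q.2 - p.2‖ ^ 2) with hN
  set m := min (ρ / 2) (κ * (ρ / 2) ^ 2) with hm
  have hm0 : 0 < m := by positivity
  have hmρ : |-m| < ρ := by
    rw [abs_neg, abs_of_pos hm0]
    exact (min_le_left _ _).trans_lt (half_lt_self hρ)
  have t1 := (t (-m)).neg
  set ψ : Spacetime d → ℝ := -fun q => φ q + (-m + N q) with hψ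
  have hψv : ∀ q, ψ q = -φ q + m - N q := fun q => by
    simp only [hψ, Pi.neg_apply]; ring
  have hψW : ∀ q ∈ Metric.closedBall p ρ ∩ cylQbar d t₀ T₁ r, ρ / 2 ≤ dist q p → ψ q ≤ W q := by
    intro q hq hd
    have h1 := le_uscEnvelope hWM' hq.2
    have h2 := hle q ⟨hU hq.1, hQ hq⟩
    have h3 : m ≤ N q := (min_le_right _ _).trans (mul_le_mul_of_nonneg_left
      ((pow_le_pow_left₀ (by positivity) hd 2).trans (sq_dist_le q p)) hκ.le)
    rw [hψv]
    rw [Pi.neg_apply] at h1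
    linarith
  classical
  set V : Spacetime d → ℝ := fun q => if dist q p < ρ then max (W q) (ψ q) else W q with hV
  have hVb : ∀ q, dist q p < ρ → V q = max (W q) (ψ q) := fun q hq => if_pos hq
  have hVo : ∀ q ∈ cylQbar d t₀ T₁ r, ρ / 2 ≤ dist q p → V q = W q := fun q hq hd => by
    by_cases h : dist q p < ρ
    · rw [hVb q h, max_eq_left (hψW q ⟨h.le, hq⟩ hd)]
    · exact if_neg h
  have hWV : ∀ q, W q ≤ V q := fun q => by
    by_cases h : dist q p < ρ
    · rw [hVb q h]; exact le_max_left _ _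
    · exact (if_neg h).ge
  have hVusc : UpperSemicontinuousOn V (cylQbar d t₀ T₁ r) := by
    intro q hq
    by_cases h : dist q p < ρ
    · have hcont : ContinuousWithinAt ψ (cylQbar d t₀ T₁ r) q :=
        (t1.cont.continuousAt (hφ.isOpen.mem_nhds (hU h.le))).continuousWithinAt
      refine UpperSemicontinuousWithinAt.congr_of_eventuallyEq
        (UpperSemicontinuousWithinAt.sup (hW q hq) hcont.upperSemicontinuousWithinAt) hq ?_
      filter_upwards [mem_nhdsWithin_of_mem_nhds (Metric.isOpen_ball.mem_nhds h)] with y hy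
      exact (hVb y hy).symm
    · refine UpperSemicontinuousWithinAt.congr_of_eventuallyEq (hW q hq) hq ?_
      have h1 : {y : Spacetime d | ρ / 2 < dist y p} ∈ 𝓝 q :=
        (isOpen_lt continuous_const (continuous_id.dist continuous_const)).mem_nhds
          ((half_lt_self hρ).trans_le (not_lt.1 h))
      filter_upwards [self_mem_nhdsWithin, mem_nhdsWithin_of_mem_nhds h1] with y hy hy1
      exact (hVo y hy (le_of_lt hy1)).symm
  have hVbd : ∃ M, ∀ q ∈ cylQbar d t₀ T₁ r, |V q| ≤ M := by
    obtain ⟨M', hM'⟩ := (isCompact_cylQbar.inter_left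
      (Metric.isClosed_closedBall (x := p) (ε := ρ))).exists_bound_of_continuousOn
      (t1.cont.mono fun q (hq : q ∈ _ ∩ cylQbar d t₀ T₁ r) => hU hq.1)
    refine ⟨max M M', fun q hq => ?_⟩
    by_cases h : dist q p < ρ
    · rw [hVb q h]
      exact abs_max_le_max_abs_abs.trans (max_le_max (hWM q hq) (hM' q ⟨h.le, hq⟩))
    · rw [show V q = W q from if_neg h]
      exact (hWM q hq).trans (le_max_left _ _)
  have hVs : ViscSubsolProp d g (cylQ d t₀ T₁ r) V := by
    refine viscSubsolProp_of fun q hq χ χt Dχ D2χ O hχ hqO heq' hle' => ?_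
    by_cases h : V q = W q
    · rw [h]
      exact hWs.le hχ hq hqO (h ▸ heq') fun y hy => (hWV y).trans (hle' y hy)
    · have hqρ : dist q p < ρ := by
        by_contra h1
        exact h (if_neg h1)
      have hVψ : V q = ψ q := by
        rw [hVb q hqρ] at h ⊢
        exact (max_choice _ _).resolve_left h
      have h1 := hg.le_of_touching hc₀ hχ (t1.mono (Metric.isOpen_ball (x := p) (ε := ρ))
        (Metric.ball_subset_closedBall.trans hU)) hq hqO hqρ (hVψ ▸ heq') fun y hy =>
          (le_max_right (W y) (ψ y)).trans ((hVb y hy.1.2).ge.trans (hle' y ⟨hy.1.1, hy.2⟩))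
      have h2 := H q ⟨hqρ.le, hq⟩ (-m) hmρ
      rw [heq']
      refine h1.trans ?_
      simp only [dualNonlinearity, Pi.neg_apply] at h2 ⊢
      change 0 < -ψt q - -g q.1 (ψ q) (-Dψ q) (-D2ψ q) at h2
      linarith
  have hVW := hmax V hVusc hVbd hVs fun q hq => by
    have hqb := cylBdry_subset_cylQbar hT hq
    by_cases h : dist q p < ρ
    · exact absurd hq (notMem_cylBdry (hQ ⟨h.le, hqb⟩))
    · exact (if_neg h).le
  -- the bump rises above the subsolution near the contact point
  obtain ⟨ρ₁, hρ₁, H₁⟩ := Metric.continuousOn_iff.1 t1.cont p hpU (m / 2) (by positivity)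
  obtain ⟨z, hz, hzp, hzW⟩ := exists_lt_of_lt_uscEnvelope hpb
    (show φ p - m / 2 < uscEnvelope (cylQbar d t₀ T₁ r) (-W) p by rw [heq]; linarith)
    (lt_min hρ hρ₁)
  have hzρ := hzp.trans_le (min_le_left _ _)
  have h1 := hVW z hz
  rw [hVb z hzρ] at h1
  have h2 := (le_max_right _ _).trans h1
  have h3 := H₁ z (hU hzρ.le) (hzp.trans_le (min_le_right _ _))
  rw [Real.dist_eq] at h3
  have h4 := (abs_lt.1 h3).1
  have h5 : ψ p = -φ p + m := by
    rw [hψv]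
    simp [hN]
  rw [Pi.neg_apply] at hzW
  linarith

end Perron

section Existence

variable {d : ℕ} {t₀ T₁ r C₀ L₀ c₀ : ℝ}
  {g : ℝ → ℝ → EuclideanSpace ℝ (Fin d) → Matrix (Fin d) (Fin d) ℝ → ℝ}

lemma exists_upper_barrier (hT : t₀ ≤ T₁) (hr : 0 < r) (hg : IsElliptic d t₀ T₁ C₀ L₀ c₀ g)
    (hL₀ : 0 ≤ L₀) (hc₀ : 0 < c₀) {h : Spacetime d → ℝ} (hh : ContinuousOn h (cylBdry d t₀ T₁ r))
    (hhb : ∃ M, ∀ p ∈ cylBdry d t₀ T₁ r, |h p| ≤ M) {b : Spacetime d}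
    (hb : b ∈ cylBdry d t₀ T₁ r) {η : ℝ} (hη : 0 < η) :
    ∃ l : Spacetime d → ℝ, Continuous l ∧ ViscSupersolProp d g (cylQ d t₀ T₁ r) l ∧
      (∀ p ∈ cylBdry d t₀ T₁ r, h p ≤ l p) ∧ l b ≤ h b + η := by
  obtain ⟨l, h1, h2, h3, h4⟩ := exists_lower_barrier hT hr hg.dual hL₀ hc₀ hh.neg
    (by simpa using hhb) hb hη
  refine ⟨-l, h1.neg, h2.neg, fun p hp => ?_, ?_⟩
  · have := h3 p hp
    simp only [Pi.neg_apply] at this ⊢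
    linarith
  · simp only [Pi.neg_apply] at h4 ⊢
    linarith

/-- Perron's method. -/
theorem exists_viscosity_solution (hT : t₀ ≤ T₁) (hr : 0 < r)
    (hg : IsElliptic d t₀ T₁ C₀ L₀ c₀ g) (hL₀ : 0 ≤ L₀) (hc₀ : 0 < c₀) {h : Spacetime d → ℝ}
    (hh : ContinuousOn h (cylBdry d t₀ T₁ r)) (hhb : ∃ M, ∀ p ∈ cylBdry d t₀ T₁ r, |h p| ≤ M) :
    ∃ v : Spacetime d → ℝ, ContinuousOn v (cylQbar d t₀ T₁ r) ∧
      (∃ M, ∀ p ∈ cylQbar d t₀ T₁ r, |v p| ≤ M) ∧ ViscSubsolProp d g (cylQ d t₀ T₁ r) v ∧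
      ViscSupersolProp d g (cylQ d t₀ T₁ r) v ∧ ∀ p ∈ cylBdry d t₀ T₁ r, v p = h p := by
  set S := cylQbar d t₀ T₁ r with hS
  have hcomp : IsCompact S := isCompact_cylQbar
  have hbdd : ∀ l : Spacetime d → ℝ, Continuous l → ∃ M, ∀ p ∈ S, |l p| ≤ M := fun l hl =>
    hcomp.exists_bound_of_continuousOn hl.continuousOn
  set F : Set (Spacetime d → ℝ) := {w | UpperSemicontinuousOn w S ∧ (∃ M, ∀ p ∈ S, |w p| ≤ M) ∧
    ViscSubsolProp d g (cylQ d t₀ T₁ r) w ∧ ∀ p ∈ cylBdry d t₀ T₁ r, w p ≤ h p} with hF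
  have hFle : ∀ w ∈ F, ∀ l : Spacetime d → ℝ, Continuous l →
      ViscSupersolProp d g (cylQ d t₀ T₁ r) l → (∀ p ∈ cylBdry d t₀ T₁ r, h p ≤ l p) →
      ∀ p ∈ S, w p ≤ l p := fun w hw l hl hls hhl =>
    comparison_principle hT hg hL₀ hc₀.le hw.1 hw.2.1 hw.2.2.1
      (hl.lowerSemicontinuous.lowerSemicontinuousOn _) (hbdd l hl) hls
      fun p hp => (hw.2.2.2 p hp).trans (hhl p hp)
  have hb₀ : ((T₁, 0) : Spacetime d) ∈ cylBdry d t₀ T₁ r :=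
    Or.inr ⟨rfl, Metric.mem_ball_self hr⟩
  obtain ⟨l₀, hl₀, hl₀s, hl₀h, -⟩ := exists_lower_barrier hT hr hg hL₀ hc₀ hh hhb hb₀ one_pos
  obtain ⟨l₁, hl₁, hl₁s, hl₁h, -⟩ := exists_upper_barrier hT hr hg hL₀ hc₀ hh hhb hb₀ one_pos
  have hlF : ∀ l : Spacetime d → ℝ, Continuous l → ViscSubsolProp d g (cylQ d t₀ T₁ r) l →
      (∀ p ∈ cylBdry d t₀ T₁ r, l p ≤ h p) → l ∈ F := fun l hl hls hlh =>
    ⟨hl.upperSemicontinuous.upperSemicontinuousOn _, hbdd l hl, hls, hlh⟩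
  -- the supremum of the subsolutions below the data
  set W₀ : Spacetime d → ℝ := fun z => sSup ((fun w => w z) '' F) with hW₀
  have hne : ∀ z, ((fun w : Spacetime d → ℝ => w z) '' F).Nonempty := fun z =>
    ⟨_, l₀, hlF l₀ hl₀ hl₀s hl₀h, rfl⟩
  have hFW : ∀ w ∈ F, ∀ z ∈ S, w z ≤ W₀ z := fun w hw z hz =>
    le_csSup ⟨l₁ z, by rintro _ ⟨w', hw', rfl⟩; exact hFle w' hw' l₁ hl₁ hl₁s hl₁h z hz⟩
      ⟨w, hw, rfl⟩
  have hWl : ∀ l : Spacetime d → ℝ, Continuous l →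
      ViscSupersolProp d g (cylQ d t₀ T₁ r) l → (∀ p ∈ cylBdry d t₀ T₁ r, h p ≤ l p) →
      ∀ p ∈ S, W₀ p ≤ l p := fun l hl hls hhl p hp =>
    csSup_le (hne p) (by rintro _ ⟨w, hw, rfl⟩; exact hFle w hw l hl hls hhl p hp)
  obtain ⟨M₁, hM₁⟩ := hbdd l₁ hl₁
  obtain ⟨M₀, hM₀⟩ := hbdd l₀ hl₀
  have hWM : ∀ z ∈ S, W₀ z ≤ M₁ := fun z hz =>
    (hWl l₁ hl₁ hl₁s hl₁h z hz).trans ((le_abs_self _).trans (hM₁ z hz))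
  set W := uscEnvelope S W₀ with hW
  have hW₀W : ∀ z ∈ S, W₀ z ≤ W z := fun z hz => le_uscEnvelope hWM hz
  have hWl' : ∀ l : Spacetime d → ℝ, Continuous l →
      ViscSupersolProp d g (cylQ d t₀ T₁ r) l → (∀ p ∈ cylBdry d t₀ T₁ r, h p ≤ l p) →
      ∀ p ∈ S, W p ≤ l p := fun l hl hls hhl p hp =>
    uscEnvelope_le_of_le (hl.upperSemicontinuous.upperSemicontinuousOn _) (hWl l hl hls hhl) hp
  have hWF : W ∈ F := by
    refine ⟨upperSemicontinuousOn_uscEnvelope hWM, ⟨max M₀ M₁, fun p hp => abs_le.2 ⟨?_, ?_⟩⟩,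
      viscSubsolProp_uscEnvelope hT hg hL₀ (F := F) (fun w hw => ⟨hw.1, hw.2.2.1⟩) hWM hFW
        fun z _ c hc => ?_, fun p hp => ?_⟩
    · have h1 := (abs_le.1 (hM₀ p hp)).1
      have h2 := hFW l₀ (hlF l₀ hl₀ hl₀s hl₀h) p hp
      linarith [hW₀W p hp, le_max_left M₀ M₁]
    · have h1 := (abs_le.1 (hM₁ p hp)).2
      linarith [hWl' l₁ hl₁ hl₁s hl₁h p hp, le_max_right M₀ M₁]
    · obtain ⟨_, ⟨w, hw, rfl⟩, h1⟩ := exists_lt_of_lt_csSup (hne z) hc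
      exact ⟨w, hw, h1⟩
    · refine le_of_forall_pos_le_add fun η hη => ?_
      obtain ⟨l, hl, hls, hhl, hlb⟩ := exists_upper_barrier hT hr hg hL₀ hc₀ hh hhb hp hη
      exact (hWl' l hl hls hhl p (cylBdry_subset_cylQbar hT hp)).trans hlb
  obtain ⟨M, hM⟩ := hWF.2.1
  have hFW' : ∀ w ∈ F, ∀ z ∈ S, w z ≤ W z := fun w hw z hz => (hFW w hw z hz).trans (hW₀W z hz)
  have hnM : ∀ z ∈ S, (-W) z ≤ M := fun z hz => by
    linarith [(abs_le.1 (hM z hz)).1, Pi.neg_apply W z]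
  -- the lower envelope
  set w := uscEnvelope S (-W) with hw
  have hws : ViscSupersolProp d g (cylQ d t₀ T₁ r) (-w) :=
    viscSupersolProp_neg_uscEnvelope_neg hT hg hL₀ hc₀.le hWF.1 hM hWF.2.2.1
      fun w' h1 h2 h3 h4 => hFW' w' ⟨h1, h2, h3, fun p hp => (h4 p hp).trans (hWF.2.2.2 p hp)⟩
  have hwW : ∀ z ∈ S, (-w) z ≤ W z := fun z hz => by
    have := le_uscEnvelope hnM hz
    simp only [Pi.neg_apply] at this ⊢
    linarith
  have hwl : LowerSemicontinuousOn (-w) S :=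
    continuous_neg.comp_upperSemicontinuousOn_antitone (upperSemicontinuousOn_uscEnvelope hnM)
      fun _ _ => neg_le_neg
  have hwlow : ∀ l ∈ F, Continuous l → ∀ z ∈ S, l z ≤ (-w) z := fun l hlF hl z hz => by
    have := uscEnvelope_le_of_le (f := -W) (k := -l)
      (hl.neg.upperSemicontinuous.upperSemicontinuousOn S)
      (fun z hz => neg_le_neg (hFW' l hlF z hz)) hz
    simp only [Pi.neg_apply] at this ⊢
    linarith
  have hwh : ∀ p ∈ cylBdry d t₀ T₁ r, h p ≤ (-w) p := fun p hp => by
    refine le_of_forall_pos_le_add fun η hη => ?_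
    obtain ⟨l, hl, hls, hlh, hlb⟩ := exists_lower_barrier hT hr hg hL₀ hc₀ hh hhb hp hη
    linarith [hwlow l (hlF l hl hls hlh) hl p (cylBdry_subset_cylQbar hT hp)]
  have hwb : ∃ M, ∀ p ∈ S, |(-w) p| ≤ M := by
    refine ⟨max M₀ M, fun p hp => abs_le.2 ⟨?_, ?_⟩⟩
    · have h1 := (abs_le.1 (hM₀ p hp)).1
      linarith [hwlow l₀ (hlF l₀ hl₀ hl₀s hl₀h) hl₀ p hp, le_max_left M₀ M]
    · exact (hwW p hp).trans ((abs_le.1 (hM p hp)).2.trans (le_max_right _ _))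
  have hWw : ∀ p ∈ S, W p ≤ (-w) p :=
    comparison_principle hT hg hL₀ hc₀.le hWF.1 hWF.2.1 hWF.2.2.1 hwl hwb hws
      fun p hp => (hWF.2.2.2 p hp).trans (hwh p hp)
  have heq : ∀ p ∈ S, W p = (-w) p := fun p hp => (hWw p hp).antisymm (hwW p hp)
  have hsub : ViscSubsolProp d g (cylQ d t₀ T₁ r) (-w) := by
    refine viscSubsolProp_of fun p hp φ φt Dφ D2φ U hφ hpU hpφ hle => ?_
    have h1 := fun q hq => heq q (cylQ_subset_cylQbar hq)
    rw [← h1 p hp] at hpφ ⊢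
    exact hWF.2.2.1.le hφ hp hpU hpφ fun q hq => (h1 q hq.2).trans_le (hle q hq)
  refine ⟨-w, continuousOn_iff_lower_upperSemicontinuousOn.2 ⟨hwl, fun z hz => ?_⟩, hwb, hsub, hws,
    fun p hp => ?_⟩
  · exact UpperSemicontinuousWithinAt.congr_of_eventuallyEq (hWF.1 z hz) hz
      (eventually_mem_nhdsWithin.mono heq)
  · have hpb := cylBdry_subset_cylQbar hT hp
    exact (((hwW p hpb).trans (hWF.2.2.2 p hp)).antisymm (hwh p hp))

end Existence

end ParabolicViscosity

/-- for a continuous, uniformly Lipschitz (in `(y,z,γ)`) and uniformly elliptic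
nonlinearity `g`, (i) the comparison principle holds for bounded viscosity sub/supersolutions
of `−∂_t w − g(s,w,Dw,D²w) = 0` on `Q = [t₀,T₁) × O`, and (ii) for every bounded continuous
boundary data `h` there is a unique bounded continuous viscosity solution with `v = h`
on `∂Q`. -/
theorem stmt_10 (d : ℕ) (hd : 1 ≤ d) (t₀ T₁ r : ℝ) (ht₀ : 0 ≤ t₀) (hT₁ : t₀ < T₁)
    (hr : 0 < r)
    (g : ℝ → ℝ → EuclideanSpace ℝ (Fin d) → Matrix (Fin d) (Fin d) ℝ → ℝ)
    (C₀ : ℝ) (hC₀ : 0 ≤ C₀) (L₀ : ℝ) (hL₀ : 0 ≤ L₀) (c₀ : ℝ) (hc₀ : 0 < c₀)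
    (hgcont : ContinuousOn
      (fun q : ℝ × ℝ × EuclideanSpace ℝ (Fin d) × Matrix (Fin d) (Fin d) ℝ =>
        g q.1 q.2.1 q.2.2.1 q.2.2.2)
      (Set.Icc t₀ T₁ ×ˢ Set.univ ×ˢ Set.univ ×ˢ {γ : Matrix (Fin d) (Fin d) ℝ | γ.IsSymm}))
    (hg0 : ∀ s ∈ Set.Icc t₀ T₁, |g s 0 0 0| ≤ C₀)
    (hgLip : ∀ s ∈ Set.Icc t₀ T₁, ∀ (y y' : ℝ) (z z' : EuclideanSpace ℝ (Fin d))
      (γ γ' : Matrix (Fin d) (Fin d) ℝ), γ.IsSymm → γ'.IsSymm →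
      |g s y z γ - g s y' z' γ'| ≤ L₀ * (|y - y'| + ‖z - z'‖ + matNorm d (γ - γ')))
    (hgell : ∀ s ∈ Set.Icc t₀ T₁, ∀ (y : ℝ) (z : EuclideanSpace ℝ (Fin d))
      (γ₁ γ₂ : Matrix (Fin d) (Fin d) ℝ), γ₁.IsSymm → γ₂.IsSymm → (γ₁ - γ₂).PosSemidef →
      c₀ * (γ₁ - γ₂).trace ≤ g s y z γ₁ - g s y z γ₂) :
    -- (i) comparison principle for bounded viscosity sub/supersolutions
    (∀ u v : ℝ × EuclideanSpace ℝ (Fin d) → ℝ,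
      UpperSemicontinuousOn u (cylQbar d t₀ T₁ r) → (∃ M, ∀ p ∈ cylQbar d t₀ T₁ r, |u p| ≤ M) →
      ViscSubsolProp d g (cylQ d t₀ T₁ r) u →
      LowerSemicontinuousOn v (cylQbar d t₀ T₁ r) → (∃ M, ∀ p ∈ cylQbar d t₀ T₁ r, |v p| ≤ M) →
      ViscSupersolProp d g (cylQ d t₀ T₁ r) v →
      (∀ p ∈ cylBdry d t₀ T₁ r, u p ≤ v p) →
      ∀ p ∈ cylQbar d t₀ T₁ r, u p ≤ v p) ∧
    -- (ii) existence and uniqueness of a bounded continuous viscosity solution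
    (∀ h : ℝ × EuclideanSpace ℝ (Fin d) → ℝ,
      ContinuousOn h (cylBdry d t₀ T₁ r) → (∃ M, ∀ p ∈ cylBdry d t₀ T₁ r, |h p| ≤ M) →
      ∃ v : ℝ × EuclideanSpace ℝ (Fin d) → ℝ,
        (ContinuousOn v (cylQbar d t₀ T₁ r) ∧ (∃ M, ∀ p ∈ cylQbar d t₀ T₁ r, |v p| ≤ M) ∧
          ViscSubsolProp d g (cylQ d t₀ T₁ r) v ∧ ViscSupersolProp d g (cylQ d t₀ T₁ r) v ∧
          ∀ p ∈ cylBdry d t₀ T₁ r, v p = h p) ∧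
        (∀ v' : ℝ × EuclideanSpace ℝ (Fin d) → ℝ,
          (ContinuousOn v' (cylQbar d t₀ T₁ r) ∧ (∃ M, ∀ p ∈ cylQbar d t₀ T₁ r, |v' p| ≤ M) ∧
            ViscSubsolProp d g (cylQ d t₀ T₁ r) v' ∧ ViscSupersolProp d g (cylQ d t₀ T₁ r) v' ∧
            ∀ p ∈ cylBdry d t₀ T₁ r, v' p = h p) →
          ∀ p ∈ cylQbar d t₀ T₁ r, v' p = v p)) := by
  have hg : IsElliptic d t₀ T₁ C₀ L₀ c₀ g := ⟨hgcont, hg0, hgLip, hgell⟩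
  refine ⟨fun u v hu hub hus hv hvb hvs hle =>
    comparison_principle hT₁.le hg hL₀ hc₀.le hu hub hus hv hvb hvs hle, fun h hh hhb => ?_⟩
  obtain ⟨v, hv, hvb, hsub, hsup, hbd⟩ :=
    exists_viscosity_solution hT₁.le hr hg hL₀ hc₀ hh hhb
  refine ⟨v, ⟨hv, hvb, hsub, hsup, hbd⟩, ?_⟩
  rintro w ⟨hw, hwb, hwsub, hwsup, hwbd⟩ p hp
  obtain ⟨hvl, hvu⟩ := continuousOn_iff_lower_upperSemicontinuousOn.1 hv
  obtain ⟨hwl, hwu⟩ := continuousOn_iff_lower_upperSemicontinuousOn.1 hw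
  exact le_antisymm
    (comparison_principle hT₁.le hg hL₀ hc₀.le hwu hwb hwsub hvl hvb hsup
      (fun q hq => ((hwbd q hq).trans (hbd q hq).symm).le) p hp)
    (comparison_principle hT₁.le hg hL₀ hc₀.le hvu hvb hsub hwl hwb hwsup
      (fun q hq => ((hbd q hq).trans (hwbd q hq).symm).le) p hp)
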